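/- Let H₁ and H₂ be subgroups of GL₂(ℤ/p²ℤ) such that for each i = 1, 2 every element of φ(Hᵢ) is a diagonal matrix. Then H₁ and H₂ are nontrivially locally conjugate in GL₂(ℤ/p²ℤ) if and only if there exist subgroups D and D' of GL₂(ℤ/p²ℤ), both consisting entirely of diagonal matrices, with D' = σDσ⁻¹ where σ = !![0,1;1,0] and D ≠ D', such that H₁ and H₂ are, in some order, conjugate in GL₂(ℤ/p²ℤ) to the subgroup generated by D together with 1 + p·!![0,1;0,0] and to the subgroup generated by D' together with 1 + p·!![0,1;0,0]. -/

import Mathlib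

open Matrix

/-- `GL₂(ℤ/nℤ)`. -/
abbrev GL2 (n : ℕ) : Type := GL (Fin 2) (ZMod n)

/-- Reduction modulo `p` from `ℤ/p²ℤ` to `ℤ/pℤ`. -/
def red (p : ℕ) : ZMod (p^2) →+* ZMod p :=
  ZMod.castHom (dvd_pow_self p (by norm_num)) (ZMod p)

/-- The natural homomorphism `φ : GL₂(ℤ/p²ℤ) →* GL₂(ℤ/pℤ)` given by entrywise
reduction modulo `p`. -/
def phi (p : ℕ) : GL2 (p^2) →* GL2 p :=
  Matrix.GeneralLinearGroup.map (red p)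

/-- The element `1 + p • A` of `GL₂(ℤ/p²ℤ)` (its inverse is `1 - p • A`). -/
def kerUnit {p : ℕ} (A : Matrix (Fin 2) (Fin 2) (ZMod (p^2))) : GL2 (p^2) where
  val := 1 + (p : ZMod (p^2)) • A
  inv := 1 - (p : ZMod (p^2)) • A
  val_inv := by
    have h : ((p : ZMod (p^2)) • A) * ((p : ZMod (p^2)) • A) = 0 := by
      rw [smul_mul_assoc, mul_smul_comm, smul_smul, ← Nat.cast_mul, ← pow_two,
        ZMod.natCast_self, zero_smul]
    rw [add_mul, one_mul, mul_sub, mul_one, h, sub_zero]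
    abel
  inv_val := by
    have h : ((p : ZMod (p^2)) • A) * ((p : ZMod (p^2)) • A) = 0 := by
      rw [smul_mul_assoc, mul_smul_comm, smul_smul, ← Nat.cast_mul, ← pow_two,
        ZMod.natCast_self, zero_smul]
    rw [sub_mul, one_mul, mul_add, mul_one, h, add_zero]
    abel

/-- The antidiagonal swap matrix `!![0,1;1,0]` as an element of `GL₂(ℤ/p²ℤ)`. -/
def swapGL (p : ℕ) : GL2 (p^2) where
  val := !![0, 1; 1, 0]
  inv := !![0, 1; 1, 0]
  val_inv := by
    ext i j
    fin_cases i <;> fin_cases j <;>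
      simp [Matrix.mul_apply, Fin.sum_univ_succ, Matrix.one_apply]
  inv_val := by
    ext i j
    fin_cases i <;> fin_cases j <;>
      simp [Matrix.mul_apply, Fin.sum_univ_succ, Matrix.one_apply]

/-- Subgroups `H₁` and `H₂` of a group `G` are locally conjugate in `G` if there is a
bijection `f : H₁ → H₂` such that `h` and `f h` are conjugate in `G` for every `h ∈ H₁`. -/
def IsLocallyConjugate {G : Type*} [Group G] (H₁ H₂ : Subgroup G) : Prop :=
  ∃ f : H₁ ≃ H₂, ∀ h : H₁, IsConj (h : G) ((f h : G))

/-- Subgroups `H₁` and `H₂` of `G` are conjugate in `G`: `g H₁ g⁻¹ = H₂` for some `g`. -/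
def IsConjugateSubgroup {G : Type*} [Group G] (H₁ H₂ : Subgroup G) : Prop :=
  ∃ g : G, Subgroup.map (MulAut.conj g).toMonoidHom H₁ = H₂

/-- Nontrivially locally conjugate: locally conjugate but not conjugate. -/
def IsNontriviallyLocallyConjugate {G : Type*} [Group G] (H₁ H₂ : Subgroup G) : Prop :=
  IsLocallyConjugate H₁ H₂ ∧ ¬ IsConjugateSubgroup H₁ H₂

set_option linter.unusedSectionVars false

section

variable {p : ℕ} [Fact p.Prime]

instance neZero_sq : NeZero (p ^ 2) := ⟨pow_ne_zero 2 (Fact.out : p.Prime).ne_zero⟩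

/-- The additive embedding `ℤ/pℤ → ℤ/p²ℤ` induced by multiplication by `p`. -/
def iota (p : ℕ) : ZMod p →+ ZMod (p ^ 2) :=
  ZMod.lift p ⟨(AddMonoidHom.mulLeft (p : ZMod (p ^ 2))).comp (Int.castAddHom _), by
    simp [← pow_two]
    exact_mod_cast ZMod.natCast_self (p ^ 2)⟩

lemma iota_red (x : ZMod (p ^ 2)) : iota p (red p x) = p * x := by
  obtain ⟨k, rfl⟩ := ZMod.intCast_surjective x
  simp [iota]

lemma red_surjective : Function.Surjective (red p) :=
  ZMod.castHom_surjective _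

lemma p_mul_p : (p : ZMod (p ^ 2)) * p = 0 := by
  rw [← pow_two]; exact_mod_cast ZMod.natCast_self (p ^ 2)

lemma mul_iota (x : ZMod (p ^ 2)) (y : ZMod p) : x * iota p y = iota p (red p x * y) := by
  obtain ⟨y, rfl⟩ := red_surjective y
  rw [← map_mul, iota_red, iota_red]; ring

lemma iota_mul (x : ZMod (p ^ 2)) (y : ZMod p) : iota p y * x = iota p (y * red p x) := by
  rw [mul_comm, mul_iota, mul_comm]

lemma red_iota (y : ZMod p) : red p (iota p y) = 0 := by
  obtain ⟨y, rfl⟩ := red_surjective y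
  simp [iota_red]

lemma iota_mul_iota (x y : ZMod p) : iota p x * iota p y = 0 := by
  rw [iota_mul, red_iota]; simp

lemma red_eq_zero_iff (x : ZMod (p ^ 2)) : red p x = 0 ↔ ∃ y, x = iota p y := by
  constructor
  · intro h
    obtain ⟨k, rfl⟩ := ZMod.intCast_surjective x
    simp only [map_intCast] at h
    obtain ⟨m, rfl⟩ := (ZMod.intCast_zmod_eq_zero_iff_dvd k p).1 h
    exact ⟨red p m, by rw [iota_red]; push_cast; ring⟩
  · rintro ⟨y, rfl⟩
    exact red_iota y

lemma iota_eq_zero (y : ZMod p) : iota p y = 0 ↔ y = 0 := by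
  constructor
  · intro h
    obtain ⟨k, rfl⟩ := ZMod.intCast_surjective y
    have h1 : iota p (red p (k : ZMod (p ^ 2))) = 0 := by simpa using h
    rw [iota_red] at h1
    have h2 : (((p : ℤ) * k : ℤ) : ZMod (p ^ 2)) = 0 := by push_cast; exact h1
    rw [ZMod.intCast_zmod_eq_zero_iff_dvd] at h2
    rw [ZMod.intCast_zmod_eq_zero_iff_dvd]
    have hp : (p : ℤ) ≠ 0 := by exact_mod_cast (Fact.out : p.Prime).ne_zero
    push_cast at h2
    rw [pow_two] at h2
    exact Int.dvd_of_mul_dvd_mul_left hp h2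
  · rintro rfl; simp

lemma iota_inj {x y : ZMod p} : iota p x = iota p y ↔ x = y := by
  rw [← sub_eq_zero, ← map_sub, iota_eq_zero, sub_eq_zero]

lemma isUnit_iff_red (x : ZMod (p ^ 2)) : IsUnit x ↔ red p x ≠ 0 := by
  constructor
  · intro h
    exact (h.map (red p)).ne_zero
  · intro h
    obtain ⟨y, hy⟩ := red_surjective (red p x)⁻¹
    have h1 : red p (x * y - 1) = 0 := by simp [hy, h]
    obtain ⟨z, hz⟩ := (red_eq_zero_iff _).1 h1
    refine IsUnit.of_mul_eq_one (y * (1 - iota p z)) ?_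
    have : x * y = 1 + iota p z := by rw [← hz]; ring
    rw [← mul_assoc, this]
    linear_combination - iota_mul_iota z z

lemma red_unit_ne_zero (x : (ZMod (p ^ 2))ˣ) : red p x ≠ 0 :=
  (isUnit_iff_red _).1 x.isUnit

lemma pow_eq_of_red_eq {x y : ZMod (p ^ 2)} (h : red p x = red p y) : x ^ p = y ^ p := by
  have h1 : red p (x - y) = 0 := by simp [h]
  obtain ⟨z, hz⟩ := (red_eq_zero_iff _).1 h1
  obtain ⟨z, rfl⟩ := red_surjective z
  have h2 : (p : ZMod (p ^ 2)) ∣ x - y := ⟨z, by rw [hz, iota_red]⟩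
  obtain ⟨k, hk⟩ := dvd_sub_pow_of_dvd_sub h2 1
  have h3 : (p : ZMod (p ^ 2)) ^ (1 + 1) = 0 := (pow_two _).trans p_mul_p
  rw [h3, zero_mul, pow_one, sub_eq_zero] at hk
  exact hk

/-- The element `1 + p A` of `GL₂(ℤ/p²ℤ)` attached to a matrix `A` over `ℤ/pℤ`. -/
def kap (A : Matrix (Fin 2) (Fin 2) (ZMod p)) : GL2 (p ^ 2) where
  val := 1 + A.map (iota p)
  inv := 1 - A.map (iota p)
  val_inv := by
    ext i j
    fin_cases i <;> fin_cases j <;>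
      simp [Matrix.mul_apply, Matrix.one_apply, add_mul, mul_sub, iota_mul_iota]
  inv_val := by
    ext i j
    fin_cases i <;> fin_cases j <;>
      simp [Matrix.mul_apply, Matrix.one_apply, mul_add, sub_mul, iota_mul_iota]

lemma kap_val (A : Matrix (Fin 2) (Fin 2) (ZMod p)) : (kap A).val = 1 + A.map (iota p) := rfl

lemma map_iota_mul_map_iota (A B : Matrix (Fin 2) (Fin 2) (ZMod p)) :
    A.map (iota p) * B.map (iota p) = 0 := by
  ext i j
  simp [Matrix.mul_apply, iota_mul_iota]

lemma kap_add (A B : Matrix (Fin 2) (Fin 2) (ZMod p)) : kap (A + B) = kap A * kap B := by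
  apply Units.ext
  rw [Units.val_mul, kap_val, kap_val, kap_val, mul_add, add_mul, add_mul, map_iota_mul_map_iota,
    Matrix.map_add _ (map_add _)]
  simp [add_assoc]

lemma kap_zero : kap (0 : Matrix (Fin 2) (Fin 2) (ZMod p)) = 1 := by
  apply Units.ext
  rw [kap_val]
  ext i j
  simp

lemma kap_neg (A : Matrix (Fin 2) (Fin 2) (ZMod p)) : kap (-A) = (kap A)⁻¹ := by
  rw [eq_inv_iff_mul_eq_one, ← kap_add]; simp [kap_zero]

lemma kap_nsmul (n : ℕ) (A : Matrix (Fin 2) (Fin 2) (ZMod p)) : kap (n • A) = (kap A) ^ n := by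
  induction n with
  | zero => simp [kap_zero]
  | succ k ih => rw [succ_nsmul, kap_add, ih]; exact (pow_succ _ _).symm

lemma kap_injective : Function.Injective (kap (p := p)) := by
  intro A B h
  have h1 : (kap A).val = (kap B).val := by rw [h]
  rw [kap_val, kap_val, add_right_inj] at h1
  ext i j
  have := congrFun (congrFun h1 i) j
  simpa [iota_inj] using this

lemma phi_apply (g : GL2 (p ^ 2)) (i j : Fin 2) : (phi p g).val i j = red p (g.val i j) := rfl

lemma phi_kap (A : Matrix (Fin 2) (Fin 2) (ZMod p)) : phi p (kap A) = 1 := by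
  apply Units.ext
  ext i j
  rw [phi_apply, kap_val]
  fin_cases i <;> fin_cases j <;> simp [red_iota]

lemma exists_kap {g : GL2 (p ^ 2)} (h : phi p g = 1) : ∃ A, g = kap A := by
  have h1 : ∀ i j, red p (g.val i j - (1 : Matrix (Fin 2) (Fin 2) (ZMod (p ^ 2))) i j) = 0 := by
    intro i j
    rw [map_sub, ← phi_apply, h]
    fin_cases i <;> fin_cases j <;> simp
  choose A hA using fun i j => (red_eq_zero_iff _).1 (h1 i j)
  refine ⟨Matrix.of A, Units.ext ?_⟩
  ext i j
  rw [kap_val]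
  simp [← hA]

lemma mul_map_iota (g : Matrix (Fin 2) (Fin 2) (ZMod (p ^ 2)))
    (A : Matrix (Fin 2) (Fin 2) (ZMod p)) :
    g * A.map (iota p) = (g.map (red p) * A).map (iota p) := by
  ext i j
  simp [Matrix.mul_apply, mul_iota]

lemma map_iota_mul (g : Matrix (Fin 2) (Fin 2) (ZMod (p ^ 2)))
    (A : Matrix (Fin 2) (Fin 2) (ZMod p)) :
    A.map (iota p) * g = (A * g.map (red p)).map (iota p) := by
  ext i j
  simp [Matrix.mul_apply, iota_mul]

lemma kap_conj (g : GL2 (p ^ 2)) (A : Matrix (Fin 2) (Fin 2) (ZMod p)) :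
    g * kap A * g⁻¹ = kap ((phi p g).val * A * (phi p g)⁻¹.val) := by
  rw [mul_inv_eq_iff_eq_mul]
  apply Units.ext
  have : (phi p g).val * A * (phi p g)⁻¹.val * g.val.map (red p) = (phi p g).val * A := by
    change (phi p g).val * A * (phi p g)⁻¹.val * (phi p g).val = (phi p g).val * A
    simp [mul_assoc]
  rw [Units.val_mul, Units.val_mul, kap_val, kap_val, mul_add, add_mul, map_iota_mul, this,
    mul_map_iota]
  simp only [mul_one, one_mul]
  rfl

lemma phi_surjective : Function.Surjective (phi p) := by
  intro g
  choose s hs using red_surjective (p := p)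
  have hm : (g.val.map s).map (red p) = g.val := by ext i j; simp [hs]
  have hu : IsUnit (g.val.map s).det := by
    rw [isUnit_iff_red, RingHom.map_det, RingHom.mapMatrix_apply, hm]
    exact ((Matrix.isUnit_iff_isUnit_det _).1 g.isUnit).ne_zero
  refine ⟨Matrix.GeneralLinearGroup.mk'' _ hu, Units.ext hm⟩

lemma kerUnit_eq : (kerUnit !![0, 1; 0, 0] : GL2 (p ^ 2)) = kap !![0, 1; 0, 0] := by
  apply Units.ext
  rw [kap_val]
  change (1 : Matrix (Fin 2) (Fin 2) (ZMod (p ^ 2))) + (p : ZMod (p ^ 2)) • !![0, 1; 0, 0] = _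
  have h : iota p 1 = p := by rw [← map_one (red p), iota_red, mul_one]
  ext i j
  fin_cases i <;> fin_cases j <;> simp [h]

end

section

variable {p : ℕ} [Fact p.Prime]

/-- Conjugation by `g` as a linear automorphism of the space of `2 × 2` matrices. -/
def conjEquiv (g : GL2 p) :
    Matrix (Fin 2) (Fin 2) (ZMod p) ≃ₗ[ZMod p] Matrix (Fin 2) (Fin 2) (ZMod p) where
  toFun A := g.val * A * g⁻¹.val
  invFun A := g⁻¹.val * A * g.val
  map_add' A B := by rw [mul_add, add_mul]
  map_smul' c A := by simp
  left_inv A := by simp [mul_assoc]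
  right_inv A := by simp [mul_assoc]

lemma conjEquiv_apply (g : GL2 p) (A : Matrix (Fin 2) (Fin 2) (ZMod p)) :
    conjEquiv g A = g.val * A * g⁻¹.val := rfl

lemma conjEquiv_mul (g h : GL2 p) (A : Matrix (Fin 2) (Fin 2) (ZMod p)) :
    conjEquiv (g * h) A = conjEquiv g (conjEquiv h A) := by
  simp [conjEquiv_apply, mul_assoc]

lemma conjEquiv_one (A : Matrix (Fin 2) (Fin 2) (ZMod p)) :
    conjEquiv (1 : GL2 p) A = A := by
  simp [conjEquiv_apply]

lemma conjEquiv_inv_apply (g : GL2 p) (A : Matrix (Fin 2) (Fin 2) (ZMod p)) :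
    conjEquiv g⁻¹ (conjEquiv g A) = A := by
  rw [← conjEquiv_mul, inv_mul_cancel, conjEquiv_one]

lemma conjEquiv_apply_one (g : GL2 p) : conjEquiv g 1 = 1 := by
  simp [conjEquiv_apply]

lemma conjEquiv_eq {g : GL2 p} {A B : Matrix (Fin 2) (Fin 2) (ZMod p)}
    (h : g.val * A = B * g.val) : conjEquiv g A = B := by
  rw [conjEquiv_apply, h]; simp [mul_assoc]

lemma exists_val_eq {G : Matrix (Fin 2) (Fin 2) (ZMod p)} (h : G.det ≠ 0) :
    ∃ g : GL2 p, g.val = G :=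
  ⟨Matrix.GeneralLinearGroup.mk'' G h.isUnit, rfl⟩

lemma trace_conjEquiv (g : GL2 p) (A : Matrix (Fin 2) (Fin 2) (ZMod p)) :
    (conjEquiv g A).trace = A.trace := by
  rw [conjEquiv_apply, Matrix.trace_mul_comm, ← mul_assoc]; simp

lemma det_conjEquiv (g : GL2 p) (A : Matrix (Fin 2) (Fin 2) (ZMod p)) :
    (conjEquiv g A).det = A.det := by
  rw [conjEquiv_apply, Matrix.det_mul_comm, ← mul_assoc]; simp

lemma trace_conjEquiv_mul (g : GL2 p) (A B : Matrix (Fin 2) (Fin 2) (ZMod p)) :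
    (conjEquiv g A * conjEquiv g B).trace = (A * B).trace := by
  rw [← trace_conjEquiv g (A * B)]
  congr 1
  simp [conjEquiv_apply, mul_assoc]

/-- Every element of `W₁` is conjugate to an element of `W₂`. -/
def IsConjInto (W₁ W₂ : Submodule (ZMod p) (Matrix (Fin 2) (Fin 2) (ZMod p))) : Prop :=
  ∀ A ∈ W₁, ∃ g : GL2 p, conjEquiv g A ∈ W₂

/-- Local conjugacy of subspaces of the space of `2 × 2` matrices. -/
def IsLocConj (W₁ W₂ : Submodule (ZMod p) (Matrix (Fin 2) (Fin 2) (ZMod p))) : Prop :=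
  ∃ f : W₁ ≃ W₂, ∀ A : W₁, ∃ g : GL2 p, conjEquiv g A.1 = (f A).1

/-- Conjugacy of subspaces of the space of `2 × 2` matrices. -/
def IsSim (W₁ W₂ : Submodule (ZMod p) (Matrix (Fin 2) (Fin 2) (ZMod p))) : Prop :=
  ∃ g : GL2 p, W₁.map (conjEquiv g).toLinearMap = W₂

variable {W₁ W₂ W₃ : Submodule (ZMod p) (Matrix (Fin 2) (Fin 2) (ZMod p))}

lemma IsLocConj.isConjInto (h : IsLocConj W₁ W₂) : IsConjInto W₁ W₂ := by
  obtain ⟨f, hf⟩ := h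
  intro A hA
  obtain ⟨g, hg⟩ := hf ⟨A, hA⟩
  exact ⟨g, by rw [hg]; exact (f _).2⟩

lemma IsLocConj.symm (h : IsLocConj W₁ W₂) : IsLocConj W₂ W₁ := by
  obtain ⟨f, hf⟩ := h
  refine ⟨f.symm, fun A => ?_⟩
  obtain ⟨g, hg⟩ := hf (f.symm A)
  rw [Equiv.apply_symm_apply] at hg
  exact ⟨g⁻¹, by rw [← hg, conjEquiv_inv_apply]⟩

lemma IsLocConj.trans (h : IsLocConj W₁ W₂) (h' : IsLocConj W₂ W₃) : IsLocConj W₁ W₃ := by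
  obtain ⟨f, hf⟩ := h
  obtain ⟨f', hf'⟩ := h'
  refine ⟨f.trans f', fun A => ?_⟩
  obtain ⟨g, hg⟩ := hf A
  obtain ⟨g', hg'⟩ := hf' (f A)
  exact ⟨g' * g, by rw [conjEquiv_mul, hg, hg']; rfl⟩

lemma IsLocConj.finrank_eq (h : IsLocConj W₁ W₂) :
    Module.finrank (ZMod p) W₁ = Module.finrank (ZMod p) W₂ := by
  obtain ⟨f, -⟩ := h
  have h1 := Nat.card_congr f
  rw [Module.natCard_eq_pow_finrank (K := ZMod p), Module.natCard_eq_pow_finrank (K := ZMod p)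
    (V := W₂)] at h1
  have hp : 1 < Nat.card (ZMod p) := by
    rw [Nat.card_zmod]; exact (Fact.out : p.Prime).one_lt
  exact Nat.pow_right_injective hp h1

lemma IsSim.isLocConj (h : IsSim W₁ W₂) : IsLocConj W₁ W₂ := by
  obtain ⟨g, rfl⟩ := h
  exact ⟨((conjEquiv g).submoduleMap W₁).toEquiv, fun A => ⟨g, rfl⟩⟩

lemma IsSim.refl (W : Submodule (ZMod p) (Matrix (Fin 2) (Fin 2) (ZMod p))) : IsSim W W :=
  ⟨1, by
    have : (conjEquiv (1 : GL2 p)).toLinearMap = LinearMap.id := LinearMap.ext conjEquiv_one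
    rw [this, Submodule.map_id]⟩

lemma IsSim.trans (h : IsSim W₁ W₂) (h' : IsSim W₂ W₃) : IsSim W₁ W₃ := by
  obtain ⟨g, rfl⟩ := h
  obtain ⟨g', rfl⟩ := h'
  refine ⟨g' * g, ?_⟩
  rw [← Submodule.map_comp]
  exact congrArg (fun f => Submodule.map f W₁) (LinearMap.ext (conjEquiv_mul g' g))

lemma isSim_map (W : Submodule (ZMod p) (Matrix (Fin 2) (Fin 2) (ZMod p))) (g : GL2 p) :
    IsSim W (W.map (conjEquiv g).toLinearMap) := ⟨g, rfl⟩

lemma IsSim.symm (h : IsSim W₁ W₂) : IsSim W₂ W₁ := by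
  obtain ⟨g, rfl⟩ := h
  refine ⟨g⁻¹, ?_⟩
  rw [← Submodule.map_comp]
  have : (conjEquiv g⁻¹).toLinearMap ∘ₗ (conjEquiv g).toLinearMap = LinearMap.id :=
    LinearMap.ext (conjEquiv_inv_apply g)
  rw [this, Submodule.map_id]

lemma isSim_of_forall_mem (g : GL2 p)
    (hr : Module.finrank (ZMod p) W₁ = Module.finrank (ZMod p) W₂)
    (h : ∀ A ∈ W₁, conjEquiv g A ∈ W₂) : IsSim W₁ W₂ := by
  refine ⟨g, Submodule.eq_of_le_of_finrank_eq ?_ ?_⟩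
  · rintro _ ⟨A, hA, rfl⟩
    exact h A hA
  · rw [← hr]
    exact LinearEquiv.finrank_map_eq (conjEquiv g) W₁

lemma eq_span_pair (hr : Module.finrank (ZMod p) W₁ = 2)
    {A B : Matrix (Fin 2) (Fin 2) (ZMod p)} (hA : A ∈ W₁) (hB : B ∈ W₁) (hA0 : A ≠ 0)
    (hAB : ∀ c : ZMod p, c • A ≠ B) : W₁ = Submodule.span (ZMod p) {A, B} := by
  have hl : LinearIndependent (ZMod p) ![A, B] := (LinearIndependent.pair_iff' hA0).2 hAB
  have hs : Set.range ![A, B] = {A, B} := by simp [Set.pair_comm]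
  symm
  refine Submodule.eq_of_le_of_finrank_eq ?_ ?_
  · rw [Submodule.span_le]
    rintro x (rfl | rfl) <;> assumption
  · have := finrank_span_eq_card hl
    rw [hs] at this
    rw [hr, this]
    rfl

lemma exists_mem_of_finrank_eq_two (hr : Module.finrank (ZMod p) W₁ = 2)
    (A : Matrix (Fin 2) (Fin 2) (ZMod p)) : ∃ B ∈ W₁, ∀ c : ZMod p, c • A ≠ B := by
  by_contra! h
  have h1 : W₁ ≤ Submodule.span (ZMod p) {A} := by
    intro B hB
    exact Submodule.mem_span_singleton.2 (h B hB)
  have h2 := Submodule.finrank_mono h1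
  have h3 := finrank_span_le_card (R := ZMod p) ({A} : Set (Matrix (Fin 2) (Fin 2) (ZMod p)))
  simp at h3
  omega

lemma isSim_of_span_pair (g : GL2 p)
    (hr : Module.finrank (ZMod p) W₁ = Module.finrank (ZMod p) W₂)
    {A B : Matrix (Fin 2) (Fin 2) (ZMod p)} (hW : W₁ = Submodule.span (ZMod p) {A, B})
    (hA : conjEquiv g A ∈ W₂) (hB : conjEquiv g B ∈ W₂) : IsSim W₁ W₂ := by
  refine isSim_of_forall_mem g hr fun X hX => ?_
  rw [hW, Submodule.mem_span_pair] at hX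
  obtain ⟨x, y, rfl⟩ := hX
  rw [map_add, map_smul, map_smul]
  exact W₂.add_mem (W₂.smul_mem _ hA) (W₂.smul_mem _ hB)

lemma isSim_of_finrank_eq_one (h : IsConjInto W₁ W₂) (hr₁ : Module.finrank (ZMod p) W₁ = 1)
    (hr₂ : Module.finrank (ZMod p) W₂ = 1) : IsSim W₁ W₂ := by
  obtain ⟨⟨A, hA⟩, -, hspan⟩ := finrank_eq_one_iff'.1 hr₁
  obtain ⟨g, hg⟩ := h A hA
  refine isSim_of_forall_mem g (hr₁.trans hr₂.symm) fun X hX => ?_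
  obtain ⟨c, hc⟩ := hspan ⟨X, hX⟩
  have : X = c • A := congrArg Subtype.val hc.symm
  rw [this, map_smul]
  exact W₂.smul_mem _ hg

lemma isSim_of_one_mem (h : IsConjInto W₁ W₂) (hr₁ : Module.finrank (ZMod p) W₁ = 2)
    (hr₂ : Module.finrank (ZMod p) W₂ = 2) (h1 : 1 ∈ W₁) : IsSim W₁ W₂ := by
  have h2 : 1 ∈ W₂ := by
    obtain ⟨g, hg⟩ := h 1 h1
    rwa [conjEquiv_apply_one] at hg
  obtain ⟨A, hA, hA'⟩ := exists_mem_of_finrank_eq_two hr₁ 1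
  obtain ⟨g, hg⟩ := h A hA
  exact isSim_of_span_pair g (hr₁.trans hr₂.symm) (eq_span_pair hr₁ h1 hA one_ne_zero hA')
    (by rwa [conjEquiv_apply_one]) hg

/-- The trace pairing on `2 × 2` matrices. -/
def tracePairing (p : ℕ) [Fact p.Prime] :
    LinearMap.BilinForm (ZMod p) (Matrix (Fin 2) (Fin 2) (ZMod p)) :=
  LinearMap.mk₂ (ZMod p) (fun A B => (A * B).trace)
    (by intros; simp [add_mul]) (by intros; simp) (by intros; simp [mul_add]) (by intros; simp)

lemma tracePairing_apply (A B : Matrix (Fin 2) (Fin 2) (ZMod p)) :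
    tracePairing p A B = (A * B).trace := rfl

lemma tracePairing_isSymm : (tracePairing p).IsSymm :=
  ⟨fun A B => by simp [tracePairing_apply, Matrix.trace_mul_comm A B]⟩

lemma tracePairing_nondegenerate : (tracePairing p).Nondegenerate := by
  have hr : LinearMap.IsRefl (tracePairing p) := fun A B h => by
    rwa [tracePairing_apply, Matrix.trace_mul_comm]
  refine hr.nondegenerate_iff_separatingLeft.2 ?_
  intro A hA
  ext i j
  have := hA (Matrix.single j i 1)
  rw [tracePairing_apply] at this
  simpa [Matrix.trace_mul_single] using this

lemma orthogonal_map (W : Submodule (ZMod p) (Matrix (Fin 2) (Fin 2) (ZMod p))) (g : GL2 p) :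
    ((tracePairing p).orthogonal W).map (conjEquiv g).toLinearMap =
      (tracePairing p).orthogonal (W.map (conjEquiv g).toLinearMap) := by
  ext A
  constructor
  · rintro ⟨A, hA, rfl⟩ _ ⟨B, hB, rfl⟩
    have := hA B hB
    rw [tracePairing_apply] at this ⊢
    exact (trace_conjEquiv_mul g B A).trans this
  · intro hA
    refine ⟨(conjEquiv g).symm A, ?_, by simp⟩
    intro B hB
    have := hA _ ⟨B, hB, rfl⟩
    rw [tracePairing_apply] at this ⊢
    rw [← trace_conjEquiv_mul g]
    simpa using this

lemma isSim_of_orthogonal (h : IsSim ((tracePairing p).orthogonal W₁)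
    ((tracePairing p).orthogonal W₂)) : IsSim W₁ W₂ := by
  obtain ⟨g, hg⟩ := h
  refine ⟨g, ?_⟩
  have h0 := fun W => LinearMap.BilinForm.orthogonal_orthogonal (tracePairing_nondegenerate (p := p))
    tracePairing_isSymm.isRefl W
  rw [← h0 W₂, ← hg, orthogonal_map, h0]

lemma finrank_orthogonal_add (W : Submodule (ZMod p) (Matrix (Fin 2) (Fin 2) (ZMod p))) :
    Module.finrank (ZMod p) ((tracePairing p).orthogonal W) = 4 - Module.finrank (ZMod p) W := by
  rw [LinearMap.BilinForm.finrank_orthogonal tracePairing_nondegenerate]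
  simp [Module.finrank_matrix]

open Classical in
/-- Local conjugacy passes to orthogonal complements for the trace pairing (in a weak form):
by Fourier inversion, a subspace meets each conjugacy class as often as its image does. -/
lemma IsLocConj.orthogonal (h : IsLocConj W₁ W₂) :
    IsConjInto ((tracePairing p).orthogonal W₁) ((tracePairing p).orthogonal W₂) := by
  intro X hX
  have hψ := (ZMod.isPrimitive_stdAddChar p)
  set ψ := ZMod.stdAddChar (N := p)
  set χ : GL2 p → Matrix (Fin 2) (Fin 2) (ZMod p) → ℂ :=
    fun g A => ψ ((A * conjEquiv g X).trace) with hχ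
  obtain ⟨f, hf⟩ := h
  have key : ∑ g, ∑ A : W₁, χ g A.1 = ∑ g, ∑ A : W₂, χ g A.1 := by
    have hc : ∑ g, ∑ A : W₂, χ g A.1 = ∑ A : W₂, ∑ g, χ g A.1 := Finset.sum_comm
    rw [Finset.sum_comm, hc, ← f.sum_comp]
    refine Finset.sum_congr rfl fun A _ => ?_
    obtain ⟨k, hk⟩ := hf A
    rw [← hk]
    refine Fintype.sum_equiv (Equiv.mulLeft k) _ _ fun g => ?_
    simp only [hχ, Equiv.coe_mulLeft, conjEquiv_mul, trace_conjEquiv_mul]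
  have hval : ∀ (W : Submodule (ZMod p) (Matrix (Fin 2) (Fin 2) (ZMod p))) (g : GL2 p),
      ∑ A : W, χ g A.1 =
        if conjEquiv g X ∈ (tracePairing p).orthogonal W then (Fintype.card W : ℂ) else 0 := by
    intro W g
    let θ : AddChar W ℂ := ψ.compAddMonoidHom
      (((tracePairing p).flip (conjEquiv g X)).comp W.subtype).toAddMonoidHom
    have hθ : ∀ A : W, χ g A.1 = θ A := fun A => rfl
    simp only [hθ, AddChar.sum_eq_ite]
    refine if_congr ?_ rfl rfl
    constructor
    · intro h0 A hA
      rw [tracePairing_apply]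
      by_contra hne
      refine hψ hne ?_
      ext c
      have := DFunLike.congr_fun h0 ⟨c • A, W.smul_mem c hA⟩
      rw [← hθ] at this
      simp only [hχ, Matrix.smul_mul, Matrix.trace_smul] at this
      simpa [AddChar.mulShift_apply, mul_comm] using this
    · intro h0
      ext A
      have := h0 A.1 A.2
      rw [tracePairing_apply] at this
      rw [← hθ]
      change ψ ((A.1 * conjEquiv g X).trace) = 1
      rw [this, AddChar.map_zero_eq_one]
  simp only [hval, ← Finset.sum_filter, Finset.sum_const, nsmul_eq_mul] at key
  by_contra! hne
  rw [Finset.filter_false_of_mem (fun g _ => hne g)] at key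
  simp only [Finset.card_empty, Nat.cast_zero, zero_mul, mul_eq_zero, Nat.cast_eq_zero,
    Fintype.card_ne_zero, or_false, Finset.card_eq_zero] at key
  have h1 : (1 : GL2 p) ∈ Finset.univ.filter
      (fun g => conjEquiv g X ∈ (tracePairing p).orthogonal W₁) := by
    simpa [conjEquiv_one] using hX
  rw [key] at h1
  simp at h1

end

section

variable {p : ℕ} [Fact p.Prime]

variable {W W₁ W₂ : Submodule (ZMod p) (Matrix (Fin 2) (Fin 2) (ZMod p))}

lemma exists_conjEquiv_eq_companion (h2 : (2 : ZMod p) ≠ 0)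
    {A : Matrix (Fin 2) (Fin 2) (ZMod p)} (hA : A ≠ 0) (ht : A.trace = 0) :
    ∃ (g : GL2 p) (u : ZMod p), conjEquiv g A = !![0, 1; u, 0] := by
  obtain ⟨a, b, c, d, rfl⟩ : ∃ a b c d, A = !![a, b; c, d] := ⟨_, _, _, _, Matrix.eta_fin_two A⟩
  obtain rfl : d = -a := by
    rw [Matrix.trace_fin_two_of] at ht
    linear_combination ht
  suffices ∃ v w : ZMod p, (a * v + b * w) * w - v * (c * v - a * w) ≠ 0 by
    obtain ⟨v, w, hvw⟩ := this
    obtain ⟨g, hg⟩ := exists_val_eq (G := !![a * v + b * w, v; c * v - a * w, w])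
      (by rwa [Matrix.det_fin_two_of])
    have h : conjEquiv g !![0, 1; a ^ 2 + b * c, 0] = !![a, b; c, -a] := by
      apply conjEquiv_eq
      rw [hg]
      ext i j
      fin_cases i <;> fin_cases j <;> simp [Matrix.mul_apply] <;> ring
    exact ⟨g⁻¹, _, by rw [← h, conjEquiv_inv_apply]⟩
  by_contra! h
  have hc : c = 0 := by have := h 1 0; linear_combination -this
  have hb : b = 0 := by have := h 0 1; linear_combination this
  have ha : 2 * a = 0 := by have := h 1 1; linear_combination this - hb + hc
  have ha : a = 0 := (mul_eq_zero.1 ha).resolve_left h2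
  apply hA
  ext i j
  fin_cases i <;> fin_cases j <;> simp [ha, hb, hc]

/-- The plane of upper triangular matrices with diagonal proportional to `(1 + a, 1 - a)`. -/
def borelPlane (a : ZMod p) : Submodule (ZMod p) (Matrix (Fin 2) (Fin 2) (ZMod p)) :=
  Submodule.span (ZMod p) {!![0, 1; 0, 0], !![1 + a, 0; 0, 1 - a]}

lemma smul_ne_of_trace (h2 : (2 : ZMod p) ≠ 0) {A X : Matrix (Fin 2) (Fin 2) (ZMod p)}
    (hA : A.trace = 0) (hX : X.trace = 2) (c : ZMod p) : c • A ≠ X := by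
  rintro rfl
  rw [Matrix.trace_smul, hA, smul_zero] at hX
  exact h2 hX.symm

lemma companion_ne_zero (u : ZMod p) : !![0, 1; u, 0] ≠ 0 := fun h => by
  have := congrFun (congrFun h 0) 1
  simp at this

lemma eq_span_companion (h2 : (2 : ZMod p) ≠ 0) (hr : Module.finrank (ZMod p) W = 2) {u : ZMod p}
    (hA : !![0, 1; u, 0] ∈ W) {X : Matrix (Fin 2) (Fin 2) (ZMod p)} (hX : X ∈ W)
    (ht : X.trace = 2) : W = Submodule.span (ZMod p) {!![0, 1; u, 0], X} :=
  eq_span_pair hr hA hX (companion_ne_zero u)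
    (smul_ne_of_trace h2 (by simp [Matrix.trace_fin_two_of]) ht)

lemma exists_det_eq (h2 : (2 : ZMod p) ≠ 0) (h : IsConjInto W₁ W₂)
    (hr : Module.finrank (ZMod p) W₂ = 2) {u : ZMod p} (hA : !![0, 1; u, 0] ∈ W₂)
    {X Y : Matrix (Fin 2) (Fin 2) (ZMod p)} (hX : X ∈ W₁) (hX' : X.trace = 2) (hY : Y ∈ W₂)
    (hY' : Y.trace = 2) : ∃ x : ZMod p, X.det = (x • !![0, 1; u, 0] + Y).det := by
  obtain ⟨g, hg⟩ := h X hX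
  rw [eq_span_companion h2 hr hA hY hY', Submodule.mem_span_pair] at hg
  obtain ⟨x, y, hxy⟩ := hg
  have h1 := congrArg Matrix.trace hxy
  rw [Matrix.trace_add, Matrix.trace_smul, Matrix.trace_smul, trace_conjEquiv, hX', hY',
    Matrix.trace_fin_two_of] at h1
  have hy : y = 1 := by
    apply mul_right_cancel₀ h2
    simpa using h1
  refine ⟨x, ?_⟩
  rw [← det_conjEquiv g X, ← hxy, hy, one_smul]

lemma exists_mem_of_nilpotent (hA : !![0, 1; 0, 0] ∈ W)
    {X : Matrix (Fin 2) (Fin 2) (ZMod p)} (hX : X ∈ W) (hX' : X.trace = 2) :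
    ∃ a c, !![1 + a, 0; c, 1 - a] ∈ W := by
  obtain ⟨a, b, c, d, rfl⟩ : ∃ a b c d, X = !![a, b; c, d] := ⟨_, _, _, _, Matrix.eta_fin_two X⟩
  refine ⟨a - 1, c, ?_⟩
  convert W.sub_mem hX (W.smul_mem b hA) using 1
  rw [Matrix.trace_fin_two_of] at hX'
  ext i j
  fin_cases i <;> fin_cases j <;> simp
  linear_combination -hX'

lemma exists_mem_of_companion (h2 : (2 : ZMod p) ≠ 0) {u : ZMod p} (hu : u ≠ 0)
    (hA : !![0, 1; u, 0] ∈ W) {X : Matrix (Fin 2) (Fin 2) (ZMod p)} (hX : X ∈ W)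
    (hX' : X.trace = 2) : ∃ a b, !![1 + a, b; -u * b, 1 - a] ∈ W := by
  obtain ⟨a, b, c, d, rfl⟩ : ∃ a b c d, X = !![a, b; c, d] := ⟨_, _, _, _, Matrix.eta_fin_two X⟩
  refine ⟨a - 1, b - (c + u * b) / (2 * u), ?_⟩
  convert W.sub_mem hX (W.smul_mem ((c + u * b) / (2 * u)) hA) using 1
  rw [Matrix.trace_fin_two_of] at hX'
  ext i j
  fin_cases i <;> fin_cases j <;> simp
  · field_simp
    ring
  · linear_combination -hX'

lemma isSim_of_nilpotent (hr : Module.finrank (ZMod p) W₁ = Module.finrank (ZMod p) W₂)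
    {a₁ c₁ a₂ c₂ : ZMod p} (hc₁ : c₁ ≠ 0) (hc₂ : c₂ ≠ 0)
    (hW : W₁ = Submodule.span (ZMod p) {!![0, 1; 0, 0], !![1 + a₁, 0; c₁, 1 - a₁]})
    (hA : !![0, 1; 0, 0] ∈ W₂) (hX : !![1 + a₂, 0; c₂, 1 - a₂] ∈ W₂) : IsSim W₁ W₂ := by
  obtain ⟨g, hg⟩ := exists_val_eq (G := !![c₁, a₂ - a₁; 0, c₂])
    (by rw [Matrix.det_fin_two_of]; simp [hc₁, hc₂])
  refine isSim_of_span_pair g hr hW ?_ ?_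
  · have : conjEquiv g !![0, 1; 0, 0] = (c₁ / c₂) • !![0, 1; 0, 0] := by
      apply conjEquiv_eq
      rw [hg]
      ext i j
      fin_cases i <;> fin_cases j <;> simp [Matrix.mul_apply]
      field_simp
    rw [this]
    exact W₂.smul_mem _ hA
  · have : conjEquiv g !![1 + a₁, 0; c₁, 1 - a₁] =
        ((a₁ ^ 2 - a₂ ^ 2) / c₂) • !![0, 1; 0, 0] + !![1 + a₂, 0; c₂, 1 - a₂] := by
      apply conjEquiv_eq
      rw [hg]
      ext i j
      fin_cases i <;> fin_cases j <;> simp [Matrix.mul_apply] <;> field_simp <;> ring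
    rw [this]
    exact W₂.add_mem (W₂.smul_mem _ hA) hX

lemma isSim_of_companion (h2 : (2 : ZMod p) ≠ 0)
    (hr : Module.finrank (ZMod p) W₁ = Module.finrank (ZMod p) W₂)
    {u a₁ b₁ a₂ b₂ : ZMod p} (hu : u ≠ 0)
    (hW : W₁ = Submodule.span (ZMod p) {!![0, 1; u, 0], !![1 + a₁, b₁; -u * b₁, 1 - a₁]})
    (hA : !![0, 1; u, 0] ∈ W₂) (hX : !![1 + a₂, b₂; -u * b₂, 1 - a₂] ∈ W₂)
    (hn : a₁ ^ 2 - u * b₁ ^ 2 = a₂ ^ 2 - u * b₂ ^ 2) (h1 : a₁ ≠ 0 ∨ b₁ ≠ 0)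
    (h1' : a₂ ≠ 0 ∨ b₂ ≠ 0) : IsSim W₁ W₂ := by
  obtain ⟨e, α, β, he, hαβ, e1, e2⟩ : ∃ e α β : ZMod p, e ^ 2 = 1 ∧ α ^ 2 - u * β ^ 2 ≠ 0 ∧
      α * (a₁ - a₂) = u * β * (e * b₁ + b₂) ∧ α * (e * b₁ - b₂) = β * (a₁ + a₂) := by
    by_contra! hne
    have key : ∀ e : ZMod p, e ^ 2 = 1 → a₁ ^ 2 - u * b₁ ^ 2 = 0 ∧ a₁ * a₂ + u * (e * b₁) * b₂ = 0 := by
      intro e he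
      have k1 : (a₁ + a₂) ^ 2 - u * (e * b₁ - b₂) ^ 2 = 0 := by
        by_contra h
        refine hne e (a₁ + a₂) (e * b₁ - b₂) he h ?_ (by ring)
        linear_combination hn - u * b₁ ^ 2 * he
      have k2 : (u * (e * b₁ + b₂)) ^ 2 - u * (a₁ - a₂) ^ 2 = 0 := by
        by_contra h
        refine hne e (u * (e * b₁ + b₂)) (a₁ - a₂) he h (by ring) ?_
        linear_combination -hn + u * b₁ ^ 2 * he
      have k3 : u * (u * (e * b₁ + b₂) ^ 2 - (a₁ - a₂) ^ 2) = 0 := by linear_combination k2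
      have k4 := (mul_eq_zero.1 k3).resolve_left hu
      constructor
      · refine mul_left_cancel₀ (mul_ne_zero h2 h2) (?_ : (2 * 2 : ZMod p) * _ = 2 * 2 * 0)
        linear_combination k1 - k4 + 2 * hn + 2 * u * b₁ ^ 2 * he
      · refine mul_left_cancel₀ (mul_ne_zero h2 h2) (?_ : (2 * 2 : ZMod p) * _ = 2 * 2 * 0)
        linear_combination k1 + k4
    obtain ⟨n, k1⟩ := key 1 (by ring)
    obtain ⟨-, k2⟩ := key (-1) (by ring)
    have k3 : a₁ * a₂ = 0 := by
      refine mul_left_cancel₀ h2 (?_ : (2 : ZMod p) * _ = 2 * 0)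
      linear_combination k1 + k2
    have z : ∀ a b : ZMod p, a ^ 2 - u * b ^ 2 = 0 → (a ≠ 0 ∨ b ≠ 0) → a ≠ 0 := by
      rintro a b hab h rfl
      rcases h with h | h
      · exact h rfl
      · have : u * b ^ 2 = 0 := by linear_combination -hab
        simp [hu, h] at this
    rcases mul_eq_zero.1 k3 with h | h
    · exact z _ _ n h1 h
    · exact z _ _ (hn ▸ n) h1' h
  obtain ⟨g, hg⟩ := exists_val_eq (G := !![α, e * β; u * β, e * α]) (by
    rw [Matrix.det_fin_two_of]
    intro h
    have : e * (α ^ 2 - u * β ^ 2) = 0 := by linear_combination h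
    rcases mul_eq_zero.1 this with h | h
    · simp [h] at he
    · exact hαβ h)
  refine isSim_of_span_pair g hr hW ?_ ?_
  · have : conjEquiv g !![0, 1; u, 0] = e • !![0, 1; u, 0] := by
      apply conjEquiv_eq
      rw [hg]
      ext i j
      fin_cases i <;> fin_cases j <;> simp [Matrix.mul_apply]
      · ring
      · linear_combination - α * he
      · ring
      · linear_combination - u * β * he
    rw [this]
    exact W₂.smul_mem _ hA
  · convert hX using 1
    apply conjEquiv_eq
    rw [hg]
    ext i j
    fin_cases i <;> fin_cases j <;> simp [Matrix.mul_apply]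
    · linear_combination e1
    · linear_combination e * e2 - α * b₁ * he
    · linear_combination -u * e2
    · linear_combination -e * e1 - u * b₁ * β * he

lemma eq_of_forall_exists_sq (h2 : (2 : ZMod p) ≠ 0) {u v w : ZMod p} (hu : u ≠ 0)
    (h : ∀ x, ∃ y, v + x ^ 2 * u = w + y ^ 2 * u) : v = w := by
  by_contra hvw
  set c := (v - w) / u with hc
  have hc0 : c ≠ 0 := div_ne_zero (sub_ne_zero.2 hvw) hu
  have h1 : ∀ n : ℕ, IsSquare ((n : ZMod p) * c) := by
    intro n
    induction n with
    | zero => simp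
    | succ k ih =>
      obtain ⟨x, hx⟩ := ih
      obtain ⟨y, hy⟩ := h x
      refine ⟨y, ?_⟩
      have : u * c = v - w := by rw [hc]; field_simp
      apply mul_left_cancel₀ hu
      push_cast
      linear_combination u * hx + this + hy
  obtain ⟨z, hz⟩ := FiniteField.exists_nonsquare (F := ZMod p) (by
    rw [ZMod.ringChar_zmod_n]
    rintro rfl
    exact h2 rfl)
  apply hz
  have := h1 (z / c).val
  rwa [ZMod.natCast_val, ZMod.cast_id, div_mul_cancel₀ _ hc0] at this

lemma classification_companion (h2 : (2 : ZMod p) ≠ 0) (h : IsLocConj W₁ W₂)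
    (hr : Module.finrank (ZMod p) W₁ = 2) {u : ZMod p} (hA₁ : !![0, 1; u, 0] ∈ W₁)
    (hA₂ : !![0, 1; u, 0] ∈ W₂) {X₁ X₂ : Matrix (Fin 2) (Fin 2) (ZMod p)} (hX₁ : X₁ ∈ W₁)
    (ht₁ : X₁.trace = 2) (hX₂ : X₂ ∈ W₂) (ht₂ : X₂.trace = 2) (n₁ : 1 ∉ W₁) (n₂ : 1 ∉ W₂) :
    IsSim W₁ W₂ ∨ ∃ a, IsSim W₁ (borelPlane a) ∧ IsSim W₂ (borelPlane (-a)) := by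
  have hr' := h.finrank_eq
  have hr₂ : Module.finrank (ZMod p) W₂ = 2 := hr'.symm.trans hr
  have htr : ∀ a b c : ZMod p, (!![1 + a, b; c, 1 - a] : Matrix (Fin 2) (Fin 2) (ZMod p)).trace = 2 := by
    intro a b c
    rw [Matrix.trace_fin_two_of]; ring
  have hone : (1 : Matrix (Fin 2) (Fin 2) (ZMod p)) = !![1 + 0, 0; 0, 1 - 0] := by
    simp [Matrix.one_fin_two]
  by_cases hu : u = 0
  · subst hu
    obtain ⟨a₁, c₁, hY₁⟩ := exists_mem_of_nilpotent hA₁ hX₁ ht₁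
    obtain ⟨a₂, c₂, hY₂⟩ := exists_mem_of_nilpotent hA₂ hX₂ ht₂
    have hd₁ : ∀ x, ∃ y, a₁ ^ 2 + x * c₁ = a₂ ^ 2 + y * c₂ := by
      intro x
      obtain ⟨y, hy⟩ := exists_det_eq h2 h.isConjInto hr₂ hA₂
        (W₁.add_mem (W₁.smul_mem x hA₁) hY₁) (by simp [htr]) hY₂ (htr _ _ _)
      refine ⟨y, ?_⟩
      simp [Matrix.det_fin_two] at hy
      linear_combination -hy
    have hd₂ : ∀ x, ∃ y, a₂ ^ 2 + x * c₂ = a₁ ^ 2 + y * c₁ := by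
      intro x
      obtain ⟨y, hy⟩ := exists_det_eq h2 h.symm.isConjInto hr hA₁
        (W₂.add_mem (W₂.smul_mem x hA₂) hY₂) (by simp [htr]) hY₁ (htr _ _ _)
      refine ⟨y, ?_⟩
      simp [Matrix.det_fin_two] at hy
      linear_combination -hy
    have hs₁ := eq_span_companion h2 hr hA₁ hY₁ (htr _ _ _)
    have hs₂ := eq_span_companion h2 hr₂ hA₂ hY₂ (htr _ _ _)
    by_cases hc₁ : c₁ = 0
    · have hc₂ : c₂ = 0 := by
        by_contra hc
        obtain ⟨y, hy⟩ := hd₂ ((a₁ ^ 2 + 1 - a₂ ^ 2) / c₂)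
        rw [div_mul_cancel₀ _ hc, hc₁] at hy
        have : (1 : ZMod p) = 0 := by linear_combination hy
        exact one_ne_zero this
      subst hc₁ hc₂
      obtain ⟨y, hy⟩ := hd₁ 0
      have : (a₂ - a₁) * (a₂ + a₁) = 0 := by linear_combination -hy
      rcases mul_eq_zero.1 this with h | h
      · left
        obtain rfl : a₂ = a₁ := by linear_combination h
        rw [hs₁, ← hs₂]
        exact IsSim.refl _
      · right
        obtain rfl : a₂ = -a₁ := by linear_combination h
        exact ⟨a₁, hs₁ ▸ IsSim.refl _, hs₂ ▸ IsSim.refl _⟩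
    · have hc₂ : c₂ ≠ 0 := by
        rintro rfl
        obtain ⟨y, hy⟩ := hd₁ ((a₂ ^ 2 + 1 - a₁ ^ 2) / c₁)
        rw [div_mul_cancel₀ _ hc₁] at hy
        have : (1 : ZMod p) = 0 := by linear_combination hy
        exact one_ne_zero this
      exact Or.inl (isSim_of_nilpotent hr' hc₁ hc₂ hs₁ hA₂ hY₂)
  · left
    obtain ⟨a₁, b₁, hY₁⟩ := exists_mem_of_companion h2 hu hA₁ hX₁ ht₁
    obtain ⟨a₂, b₂, hY₂⟩ := exists_mem_of_companion h2 hu hA₂ hX₂ ht₂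
    refine isSim_of_companion h2 hr' hu (eq_span_companion h2 hr hA₁ hY₁ (htr _ _ _)) hA₂ hY₂ ?_ ?_ ?_
    · refine eq_of_forall_exists_sq h2 hu fun x => ?_
      obtain ⟨y, hy⟩ := exists_det_eq h2 h.isConjInto hr₂ hA₂
        (W₁.add_mem (W₁.smul_mem x hA₁) hY₁) (by simp [htr]) hY₂ (htr _ _ _)
      refine ⟨y, ?_⟩
      simp [Matrix.det_fin_two] at hy
      linear_combination -hy
    · by_contra! h0
      apply n₁
      rw [hone]
      simpa [h0.1, h0.2] using hY₁
    · by_contra! h0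
      apply n₂
      rw [hone]
      simpa [h0.1, h0.2] using hY₂

lemma one_mem_orthogonal_iff :
    1 ∈ (tracePairing p).orthogonal W ↔ ∀ A ∈ W, A.trace = 0 := by
  refine forall₂_congr fun A _ => ?_
  rw [tracePairing_apply, mul_one]

/-- Locally conjugate subspaces of `2 × 2` matrices are conjugate, up to a pair of planes in the
space of upper triangular matrices. -/
theorem isSim_or_isSim_borelPlane (h2 : (2 : ZMod p) ≠ 0) (h : IsLocConj W₁ W₂) :
    IsSim W₁ W₂ ∨ ∃ a, IsSim W₁ (borelPlane a) ∧ IsSim W₂ (borelPlane (-a)) := by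
  have hr := h.finrank_eq
  have h4 : Module.finrank (ZMod p) (Matrix (Fin 2) (Fin 2) (ZMod p)) = 4 := by
    simp [Module.finrank_matrix]
  have hle := Submodule.finrank_le W₁
  obtain h0 | h0 | h0 | h0 | h0 : Module.finrank (ZMod p) W₁ = 0 ∨ Module.finrank (ZMod p) W₁ = 1 ∨
    Module.finrank (ZMod p) W₁ = 2 ∨ Module.finrank (ZMod p) W₁ = 3 ∨
    Module.finrank (ZMod p) W₁ = 4 := by omega
  · left
    rw [Submodule.finrank_eq_zero.1 h0, Submodule.finrank_eq_zero.1 (hr.symm.trans h0)]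
    exact IsSim.refl _
  · exact Or.inl (isSim_of_finrank_eq_one h.isConjInto h0 (hr.symm.trans h0))
  · have ho₁ := finrank_orthogonal_add W₁
    have ho₂ := finrank_orthogonal_add W₂
    by_cases n₁ : 1 ∈ W₁
    · exact Or.inl (isSim_of_one_mem h.isConjInto h0 (hr.symm.trans h0) n₁)
    by_cases n₂ : 1 ∈ W₂
    · exact Or.inl (isSim_of_one_mem h.symm.isConjInto (hr.symm.trans h0) h0 n₂).symm
    by_cases m₁ : 1 ∈ (tracePairing p).orthogonal W₁
    · exact Or.inl (isSim_of_orthogonal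
        (isSim_of_one_mem h.orthogonal (by omega) (by omega) m₁))
    by_cases m₂ : 1 ∈ (tracePairing p).orthogonal W₂
    · exact Or.inl (isSim_of_orthogonal
        (isSim_of_one_mem h.symm.orthogonal (by omega) (by omega) m₂)).symm
    have hex : ∀ W : Submodule (ZMod p) (Matrix (Fin 2) (Fin 2) (ZMod p)),
        1 ∉ (tracePairing p).orthogonal W → ∃ X ∈ W, X.trace = 2 := by
      intro W hW
      rw [one_mem_orthogonal_iff] at hW
      push Not at hW
      obtain ⟨X, hX, hX0⟩ := hW
      exact ⟨(2 / X.trace) • X, W.smul_mem _ hX, by simp [hX0]⟩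
    obtain ⟨X₁, hX₁, ht₁⟩ := hex W₁ m₁
    obtain ⟨X₂, hX₂, ht₂⟩ := hex W₂ m₂
    obtain ⟨Y, hY, hYX⟩ := exists_mem_of_finrank_eq_two h0 X₁
    set A := Y - (Y.trace / 2) • X₁ with hA
    have hAW : A ∈ W₁ := W₁.sub_mem hY (W₁.smul_mem _ hX₁)
    have hA0 : A ≠ 0 := fun h0 => hYX _ (sub_eq_zero.1 h0).symm
    have hAt : A.trace = 0 := by simp [hA, ht₁, h2]
    obtain ⟨g₁, u, hu⟩ := exists_conjEquiv_eq_companion h2 hA0 hAt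
    obtain ⟨k, hk⟩ := h.isConjInto A hAW
    have hk' : conjEquiv (g₁ * k⁻¹) (conjEquiv k A) = !![0, 1; u, 0] := by
      rw [conjEquiv_mul, conjEquiv_inv_apply, hu]
    have s₁ := isSim_map W₁ g₁
    have s₂ := isSim_map W₂ (g₁ * k⁻¹)
    have hn : ∀ (W : Submodule (ZMod p) (Matrix (Fin 2) (Fin 2) (ZMod p))) (g : GL2 p), 1 ∉ W →
        1 ∉ W.map (conjEquiv g).toLinearMap := by
      rintro W g hW ⟨X, hX, hX1⟩
      apply hW
      have h1 : X = 1 := (conjEquiv g).injective (hX1.trans (conjEquiv_apply_one g).symm)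
      exact h1 ▸ hX
    rcases classification_companion h2 (s₁.symm.isLocConj.trans (h.trans s₂.isLocConj))
      (s₁.isLocConj.finrank_eq.symm.trans h0) ⟨A, hAW, hu⟩ ⟨_, hk, hk'⟩
      ⟨X₁, hX₁, rfl⟩ ((trace_conjEquiv _ _).trans ht₁)
      ⟨X₂, hX₂, rfl⟩ ((trace_conjEquiv _ _).trans ht₂) (hn _ _ n₁) (hn _ _ n₂) with hs | ⟨a, hs, hs'⟩
    · exact Or.inl (s₁.trans (hs.trans s₂.symm))
    · exact Or.inr ⟨a, s₁.trans hs, s₂.trans hs'⟩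
  · left
    have ho₁ := finrank_orthogonal_add W₁
    have ho₂ := finrank_orthogonal_add W₂
    exact isSim_of_orthogonal (isSim_of_finrank_eq_one h.orthogonal (by omega) (by omega))
  · left
    rw [Submodule.eq_top_of_finrank_eq (h0.trans h4.symm),
      Submodule.eq_top_of_finrank_eq ((hr.symm.trans h0).trans h4.symm)]
    exact IsSim.refl _

end

section

lemma IsLocallyConjugate.symm {G : Type*} [Group G] {H K : Subgroup G}
    (h : IsLocallyConjugate H K) : IsLocallyConjugate K H := by
  obtain ⟨f, hf⟩ := h
  exact ⟨f.symm, fun k => by simpa using (hf (f.symm k)).symm⟩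

lemma IsLocallyConjugate.trans {G : Type*} [Group G] {H K L : Subgroup G}
    (h : IsLocallyConjugate H K) (h' : IsLocallyConjugate K L) : IsLocallyConjugate H L := by
  obtain ⟨f, hf⟩ := h
  obtain ⟨f', hf'⟩ := h'
  exact ⟨f.trans f', fun k => (hf k).trans (hf' _)⟩

lemma IsLocallyConjugate.card_eq {G : Type*} [Group G] {H K : Subgroup G}
    (h : IsLocallyConjugate H K) : Nat.card H = Nat.card K :=
  Nat.card_congr h.choose

lemma IsConjugateSubgroup.isLocallyConjugate {G : Type*} [Group G] {H K : Subgroup G}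
    (h : IsConjugateSubgroup H K) : IsLocallyConjugate H K := by
  obtain ⟨g, rfl⟩ := h
  exact ⟨(H.equivMapOfInjective _ (MulAut.conj g).injective).toEquiv,
    fun k => isConj_iff.2 ⟨g, rfl⟩⟩

lemma IsConjugateSubgroup.symm {G : Type*} [Group G] {H K : Subgroup G}
    (h : IsConjugateSubgroup H K) : IsConjugateSubgroup K H := by
  obtain ⟨g, rfl⟩ := h
  refine ⟨g⁻¹, ?_⟩
  rw [Subgroup.map_map]
  convert Subgroup.map_id H
  ext x
  simp [mul_assoc]

lemma IsConjugateSubgroup.trans {G : Type*} [Group G] {H K L : Subgroup G}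
    (h : IsConjugateSubgroup H K) (h' : IsConjugateSubgroup K L) : IsConjugateSubgroup H L := by
  obtain ⟨g, rfl⟩ := h
  obtain ⟨g', rfl⟩ := h'
  refine ⟨g' * g, ?_⟩
  rw [Subgroup.map_map]
  congr 1
  ext x
  simp

lemma isConjugateSubgroup_map {G : Type*} [Group G] (g : G) (H : Subgroup G) :
    IsConjugateSubgroup H (H.map (MulAut.conj g).toMonoidHom) := ⟨g, rfl⟩

lemma isConjugateSubgroup_of_forall_mem {G : Type*} [Group G] [Finite G] {H K : Subgroup G} (g : G)
    (hc : Nat.card H = Nat.card K) (h : ∀ x ∈ H, g * x * g⁻¹ ∈ K) : IsConjugateSubgroup H K := by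
  refine ⟨g, Subgroup.eq_of_le_of_card_ge ?_ ?_⟩
  · rintro _ ⟨x, hx, rfl⟩
    exact h x hx
  · exact ((Nat.card_congr (H.equivMapOfInjective (MulAut.conj g).toMonoidHom
      (MulAut.conj g).injective).toEquiv).symm.trans hc).ge

lemma isNontriviallyLocallyConjugate_congr {G : Type*} [Group G] {H K H' K' : Subgroup G}
    (h : IsConjugateSubgroup H H') (k : IsConjugateSubgroup K K') :
    IsNontriviallyLocallyConjugate H K ↔ IsNontriviallyLocallyConjugate H' K' := by
  constructor
  · rintro ⟨h₁, h₂⟩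
    exact ⟨h.symm.isLocallyConjugate.trans (h₁.trans k.isLocallyConjugate),
      fun h₃ => h₂ (h.trans (h₃.trans k.symm))⟩
  · rintro ⟨h₁, h₂⟩
    exact ⟨h.isLocallyConjugate.trans (h₁.trans k.symm.isLocallyConjugate),
      fun h₃ => h₂ (h.symm.trans (h₃.trans k))⟩

variable {p : ℕ} [Fact p.Prime]

/-- The embedding of the diagonal torus into `GL₂(ℤ/p²ℤ)`. -/
def diagHom (p : ℕ) : (ZMod (p ^ 2))ˣ × (ZMod (p ^ 2))ˣ →* GL2 (p ^ 2) where
  toFun x :=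
    { val := !![(x.1 : ZMod (p ^ 2)), 0; 0, x.2]
      inv := !![((x.1⁻¹ : (ZMod (p ^ 2))ˣ) : ZMod (p ^ 2)), 0; 0, (x.2⁻¹ : (ZMod (p ^ 2))ˣ)]
      val_inv := by simp [Matrix.one_fin_two]
      inv_val := by simp [Matrix.one_fin_two] }
  map_one' := by
    apply Units.ext
    simp [Matrix.one_fin_two]
  map_mul' x y := by
    apply Units.ext
    simp

lemma diagHom_val (x : (ZMod (p ^ 2))ˣ × (ZMod (p ^ 2))ˣ) :
    (diagHom p x).val = !![(x.1 : ZMod (p ^ 2)), 0; 0, x.2] := rfl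

lemma diagHom_injective : Function.Injective (diagHom p) := by
  intro x y h
  have h1 : (diagHom p x).val = (diagHom p y).val := by rw [h]
  rw [diagHom_val, diagHom_val] at h1
  have h2 := congrFun (congrFun h1 0) 0
  have h3 := congrFun (congrFun h1 1) 1
  exact Prod.ext (Units.ext (by simpa using h2)) (Units.ext (by simpa using h3))

lemma isDiag_diagHom (x : (ZMod (p ^ 2))ˣ × (ZMod (p ^ 2))ˣ) : (diagHom p x).val.IsDiag := by
  rw [diagHom_val]
  intro i j h
  fin_cases i <;> fin_cases j <;> simp at h ⊢

lemma exists_diagHom_val {g : GL2 (p ^ 2)} {a d : ZMod (p ^ 2)} (h : g.val = !![a, 0; 0, d]) :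
    ∃ x, g = diagHom p x := by
  have h1 : IsUnit (a * d) := by
    have := (Matrix.isUnit_iff_isUnit_det _).1 g.isUnit
    rwa [h, Matrix.det_fin_two_of, mul_zero, sub_zero] at this
  obtain ⟨⟨a, rfl⟩, ⟨d, rfl⟩⟩ := IsUnit.mul_iff.1 h1
  exact ⟨(a, d), Units.ext (by rw [h, diagHom_val])⟩

lemma exists_diagHom {g : GL2 (p ^ 2)} (h : g.val.IsDiag) : ∃ x, g = diagHom p x := by
  refine exists_diagHom_val (a := g.val 0 0) (d := g.val 1 1) ?_
  have h1 := h (show (0 : Fin 2) ≠ 1 by decide)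
  have h2 := h (show (1 : Fin 2) ≠ 0 by decide)
  rw [Matrix.eta_fin_two g.val, h1, h2]
  rfl

lemma conj_swapGL_diagHom (x : (ZMod (p ^ 2))ˣ × (ZMod (p ^ 2))ˣ) :
    swapGL p * diagHom p x * (swapGL p)⁻¹ = diagHom p x.swap := by
  rw [mul_inv_eq_iff_eq_mul]
  apply Units.ext
  rw [Units.val_mul, Units.val_mul, diagHom_val, diagHom_val]
  simp [swapGL]

/-- Exchanging the coordinates of a subgroup of the diagonal torus. -/
def swapSubgroup (E : Subgroup ((ZMod (p ^ 2))ˣ × (ZMod (p ^ 2))ˣ)) :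
    Subgroup ((ZMod (p ^ 2))ˣ × (ZMod (p ^ 2))ˣ) :=
  E.comap (MulEquiv.prodComm (M := (ZMod (p ^ 2))ˣ) (N := (ZMod (p ^ 2))ˣ)).toMonoidHom

lemma mem_swapSubgroup {E : Subgroup ((ZMod (p ^ 2))ˣ × (ZMod (p ^ 2))ˣ)}
    {x : (ZMod (p ^ 2))ˣ × (ZMod (p ^ 2))ˣ} : x ∈ swapSubgroup E ↔ x.swap ∈ E := Iff.rfl

lemma swapSubgroup_swapSubgroup (E : Subgroup ((ZMod (p ^ 2))ˣ × (ZMod (p ^ 2))ˣ)) :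
    swapSubgroup (swapSubgroup E) = E := by
  ext x
  simp [mem_swapSubgroup]

lemma map_swapSubgroup (E : Subgroup ((ZMod (p ^ 2))ˣ × (ZMod (p ^ 2))ˣ)) :
    (E.map (diagHom p)).map (MulAut.conj (swapGL p)).toMonoidHom =
      (swapSubgroup E).map (diagHom p) := by
  ext g
  constructor
  · rintro ⟨_, ⟨x, hx, rfl⟩, rfl⟩
    exact ⟨x.swap, hx, (conj_swapGL_diagHom x).symm⟩
  · rintro ⟨x, hx, rfl⟩
    exact ⟨_, ⟨x.swap, hx, rfl⟩, conj_swapGL_diagHom x.swap⟩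

lemma diagHom_mul_kap_val (x : (ZMod (p ^ 2))ˣ × (ZMod (p ^ 2))ˣ) (b : ZMod p) :
    (diagHom p x * kap !![0, b; 0, 0]).val = !![(x.1 : ZMod (p ^ 2)), x.1 * iota p b; 0, x.2] := by
  rw [Units.val_mul, diagHom_val, kap_val]
  ext i j
  fin_cases i <;> fin_cases j <;> simp [Matrix.mul_apply]

lemma phi_diagHom_val (x : (ZMod (p ^ 2))ˣ × (ZMod (p ^ 2))ˣ) :
    (phi p (diagHom p x)).val = !![red p x.1, 0; 0, red p x.2] := by
  ext i j
  rw [phi_apply, diagHom_val]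
  fin_cases i <;> fin_cases j <;> simp

/-- Conjugating `1 + pA` by a diagonal matrix. -/
lemma diagHom_conj_kap (x : (ZMod (p ^ 2))ˣ × (ZMod (p ^ 2))ˣ) (a b c d : ZMod p) :
    diagHom p x * kap !![a, b; c, d] * (diagHom p x)⁻¹ =
      kap !![a, red p x.1 / red p x.2 * b; red p x.2 / red p x.1 * c, d] := by
  have h1 := red_unit_ne_zero x.1
  have h2 := red_unit_ne_zero x.2
  rw [kap_conj]
  congr 1
  rw [← conjEquiv_apply]
  apply conjEquiv_eq
  rw [phi_diagHom_val]
  ext i j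
  fin_cases i <;> fin_cases j <;> simp [Matrix.mul_apply] <;> field_simp

lemma kap_mul_diagHom (x : (ZMod (p ^ 2))ˣ × (ZMod (p ^ 2))ˣ) (a b c d : ZMod p) :
    kap !![a, b; c, d] * diagHom p x = diagHom p x *
      kap !![a, red p x.2 / red p x.1 * b; red p x.1 / red p x.2 * c, d] := by
  have h1 := red_unit_ne_zero x.1
  have h2 := red_unit_ne_zero x.2
  have h := diagHom_conj_kap x a (red p x.2 / red p x.1 * b) (red p x.1 / red p x.2 * c) d
  rw [mul_inv_eq_iff_eq_mul] at h
  rw [h]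
  congr 3
  field_simp

/-- The subgroup generated by the diagonal matrices in `E` and `1 + p * !![0, 1; 0, 0]`. -/
def triSubgroup (E : Subgroup ((ZMod (p ^ 2))ˣ × (ZMod (p ^ 2))ˣ)) : Subgroup (GL2 (p ^ 2)) where
  carrier := {g | ∃ x ∈ E, ∃ b, g = diagHom p x * kap !![0, b; 0, 0]}
  one_mem' := ⟨1, E.one_mem, 0, by
    have : !![0, 0; 0, 0] = (0 : Matrix (Fin 2) (Fin 2) (ZMod p)) := (Matrix.eta_fin_two 0).symm
    rw [this, kap_zero, map_one, one_mul]⟩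
  mul_mem' := by
    rintro _ _ ⟨x, hx, b, rfl⟩ ⟨y, hy, c, rfl⟩
    refine ⟨x * y, E.mul_mem hx hy, red p y.2 / red p y.1 * b + c, ?_⟩
    have : !![0, red p y.2 / red p y.1 * b + c; 0, 0] =
      !![0, red p y.2 / red p y.1 * b; red p y.1 / red p y.2 * 0, 0] + !![0, c; 0, 0] := by simp
    rw [this, kap_add, map_mul, mul_assoc (diagHom p x) (diagHom p y),
      ← mul_assoc (diagHom p y), ← kap_mul_diagHom]
    simp only [mul_assoc]
  inv_mem' := by
    rintro _ ⟨x, hx, b, rfl⟩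
    refine ⟨x⁻¹, E.inv_mem hx,
      red p (x⁻¹).2 / red p (x⁻¹).1 * -b, ?_⟩
    have h := kap_mul_diagHom x⁻¹ 0 (-b) 0 0
    rw [mul_zero] at h
    rw [← h]
    have : !![0, -b; 0, 0] = -!![0, b; 0, 0] := by simp
    rw [this, kap_neg, map_inv]
    exact _root_.mul_inv_rev _ _

lemma kap_smul_mem {H : Subgroup (GL2 (p ^ 2))} {A : Matrix (Fin 2) (Fin 2) (ZMod p)}
    (hA : kap A ∈ H) (c : ZMod p) : kap (c • A) ∈ H := by
  have : c • A = c.val • A := by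
    rw [← Nat.cast_smul_eq_nsmul (ZMod p), ZMod.natCast_zmod_val]
  rw [this, kap_nsmul]
  exact H.pow_mem hA _

lemma closure_eq_triSubgroup (E : Subgroup ((ZMod (p ^ 2))ˣ × (ZMod (p ^ 2))ˣ)) :
    Subgroup.closure ((E.map (diagHom p) : Set (GL2 (p ^ 2))) ∪ {kerUnit !![0, 1; 0, 0]}) =
      triSubgroup E := by
  rw [kerUnit_eq]
  apply le_antisymm
  · rw [Subgroup.closure_le]
    rintro _ (⟨x, hx, rfl⟩ | rfl)
    · refine ⟨x, hx, 0, ?_⟩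
      have : !![0, 0; 0, 0] = (0 : Matrix (Fin 2) (Fin 2) (ZMod p)) := (Matrix.eta_fin_two 0).symm
      rw [this, kap_zero, mul_one]
    · exact ⟨1, E.one_mem, 1, by rw [map_one, one_mul]⟩
  · rintro _ ⟨x, hx, b, rfl⟩
    refine Subgroup.mul_mem _ (Subgroup.subset_closure (Or.inl ⟨x, hx, rfl⟩)) ?_
    have : !![0, b; 0, 0] = b • !![0, 1; 0, 0] := by simp
    rw [this]
    exact kap_smul_mem (Subgroup.subset_closure (Or.inr rfl)) b

lemma eq_triSubgroup {K : Subgroup (GL2 (p ^ 2))} (h1 : kap !![0, 1; 0, 0] ∈ K)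
    (h : ∀ g ∈ K, ∃ x b, g = diagHom p x * kap !![0, b; 0, 0]) :
    K = triSubgroup (K.comap (diagHom p)) := by
  have h2 : ∀ b, kap !![0, b; 0, 0] ∈ K := fun b => by
    have : !![0, b; 0, 0] = b • !![0, 1; 0, 0] := by simp
    rw [this]
    exact kap_smul_mem h1 b
  ext g
  constructor
  · intro hg
    obtain ⟨x, b, rfl⟩ := h g hg
    exact ⟨x, (K.mul_mem_cancel_right (h2 b)).1 hg, b, rfl⟩
  · rintro ⟨x, hx, b, rfl⟩
    exact K.mul_mem hx (h2 b)

lemma isConj_swap (x : (ZMod (p ^ 2))ˣ × (ZMod (p ^ 2))ˣ) (b : ZMod p) :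
    IsConj (diagHom p x * kap !![0, b; 0, 0]) (diagHom p x.swap * kap !![0, b; 0, 0]) := by
  suffices h : ∃ G : Matrix (Fin 2) (Fin 2) (ZMod (p ^ 2)), IsUnit G.det ∧
      G * (diagHom p x * kap !![0, b; 0, 0]).val =
        (diagHom p x.swap * kap !![0, b; 0, 0]).val * G by
    obtain ⟨G, hG, h⟩ := h
    refine isConj_iff.2 ⟨Matrix.GeneralLinearGroup.mk'' G hG, ?_⟩
    rw [mul_inv_eq_iff_eq_mul]
    exact Units.ext h
  obtain ⟨a, d⟩ := x
  simp only [diagHom_mul_kap_val, Prod.swap]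
  by_cases had : red p (a - d) = 0
  · obtain ⟨c, hc⟩ := (red_eq_zero_iff _).1 had
    have hc' : (a : ZMod (p ^ 2)) = d + iota p c := by rw [← hc]; ring
    have had' : red p a = red p d := by rw [hc', map_add, red_iota, add_zero]
    by_cases hb : b = 0
    · refine ⟨!![0, 1; 1, 0], by simp, ?_⟩
      simp [hb]
    · obtain ⟨β, hβ⟩ := red_surjective (red p d * b)
      obtain ⟨γ, hγ⟩ := red_surjective c
      refine ⟨!![β, 0; γ, β], ?_, ?_⟩
      · rw [Matrix.det_fin_two_of, zero_mul, sub_zero, isUnit_iff_red, map_mul, hβ]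
        have := red_unit_ne_zero d
        simp [hb, this]
      · ext i j
        fin_cases i <;> fin_cases j <;>
          simp only [Matrix.mul_apply, Fin.sum_univ_two] <;>
          simp [mul_iota, iota_mul, hc', mul_add, add_mul, hβ, hγ, red_iota] <;> ring_nf
  · obtain ⟨u, hu⟩ := (isUnit_iff_red _).2 had
    have hu' : (a - d) * (u⁻¹ : (ZMod (p ^ 2))ˣ) = (1 : ZMod (p ^ 2)) := by
      rw [← hu, Units.mul_inv]
    refine ⟨!![d * iota p b * (u⁻¹ : (ZMod (p ^ 2))ˣ), 1; 1, a * iota p b * (u⁻¹ : (ZMod (p ^ 2))ˣ)],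
      ?_, ?_⟩
    · rw [Matrix.det_fin_two_of, isUnit_iff_red]
      simp [red_iota]
    · have hz : iota p b * iota p b = 0 := iota_mul_iota b b
      ext i j
      fin_cases i <;> fin_cases j <;> simp [Matrix.mul_apply]
      · linear_combination d * iota p b * hu'
      · ring
      · linear_combination -a * iota p b * hu'

lemma isLocallyConjugate_triSubgroup (E : Subgroup ((ZMod (p ^ 2))ˣ × (ZMod (p ^ 2))ˣ)) :
    IsLocallyConjugate (triSubgroup E) (triSubgroup (swapSubgroup E)) := by
  have key : ∀ E : Subgroup ((ZMod (p ^ 2))ˣ × (ZMod (p ^ 2))ˣ),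
      ∃ f : E × ZMod p ≃ triSubgroup E, ∀ x b, (f (x, b) : GL2 (p ^ 2)) =
        diagHom p x * kap !![0, b; 0, 0] := by
    intro E
    refine ⟨Equiv.ofBijective (fun y => ⟨diagHom p y.1 * kap !![0, y.2; 0, 0],
      ⟨y.1, y.1.2, y.2, rfl⟩⟩) ⟨?_, ?_⟩, fun x b => rfl⟩
    · rintro ⟨⟨x, hx⟩, b⟩ ⟨⟨y, hy⟩, c⟩ h
      have h0 := congrArg (fun g : GL2 (p ^ 2) => g.val) (Subtype.ext_iff.1 h)
      simp only [diagHom_mul_kap_val] at h0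
      have e1 : (x.1 : ZMod (p ^ 2)) = y.1 := by simpa using congrFun (congrFun h0 0) 0
      have e2 : (x.2 : ZMod (p ^ 2)) = y.2 := by simpa using congrFun (congrFun h0 1) 1
      have e3 : (x.1 : ZMod (p ^ 2)) * iota p b = y.1 * iota p c := by
        simpa using congrFun (congrFun h0 0) 1
      rw [← e1, Units.mul_right_inj, iota_inj] at e3
      have e4 : x = y := Prod.ext (Units.ext e1) (Units.ext e2)
      simp [e3, e4]
    · rintro ⟨_, x, hx, b, rfl⟩
      exact ⟨(⟨x, hx⟩, b), rfl⟩
  obtain ⟨f, hf⟩ := key E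
  obtain ⟨f', hf'⟩ := key (swapSubgroup E)
  let e : E ≃ swapSubgroup E := (Equiv.prodComm _ _).subtypeEquiv fun x => Iff.rfl
  refine ⟨f.symm.trans ((e.prodCongr (Equiv.refl _)).trans f'), fun h => ?_⟩
  obtain ⟨⟨x, b⟩, rfl⟩ := f.surjective h
  simp only [Equiv.trans_apply, Equiv.symm_apply_apply, Equiv.prodCongr_apply, Prod.map_apply]
  rw [hf, hf']
  exact isConj_swap x.1 b

lemma swapSubgroup_eq_of_isConjugateSubgroup {E E' : Subgroup ((ZMod (p ^ 2))ˣ × (ZMod (p ^ 2))ˣ)}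
    (h : IsConjugateSubgroup (triSubgroup E) (triSubgroup E')) : E ≤ E' := by
  obtain ⟨g, hg⟩ := h
  have key : ∀ x ∈ E, ∀ b, ∃ y ∈ E', ∃ c, g.val * (diagHom p x * kap !![0, b; 0, 0]).val =
      (diagHom p y * kap !![0, c; 0, 0]).val * g.val := by
    intro x hx b
    have : g * (diagHom p x * kap !![0, b; 0, 0]) * g⁻¹ ∈ triSubgroup E' := by
      rw [← hg]
      exact ⟨_, ⟨x, hx, b, rfl⟩, rfl⟩
    obtain ⟨y, hy, c, h⟩ := this
    rw [mul_inv_eq_iff_eq_mul] at h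
    exact ⟨y, hy, c, congrArg (fun g : GL2 (p ^ 2) => g.val) h⟩
  obtain ⟨α, β, γ, δ, hG⟩ : ∃ α β γ δ, g.val = !![α, β; γ, δ] := ⟨_, _, _, _, Matrix.eta_fin_two _⟩
  have hdet : IsUnit (α * δ - β * γ) := by
    rw [← Matrix.det_fin_two_of, ← hG]
    exact (Matrix.isUnit_iff_isUnit_det _).1 g.isUnit
  rw [hG] at key
  simp only [diagHom_mul_kap_val] at key
  have hγ : red p γ = 0 := by
    obtain ⟨y, -, c, h⟩ := key 1 E.one_mem 1
    have e1 := congrFun (congrFun h 1) 0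
    have e2 := congrFun (congrFun h 1) 1
    simp [Matrix.mul_apply] at e1 e2
    by_contra hne
    obtain ⟨u, rfl⟩ := (isUnit_iff_red _).2 hne
    have e3 : (y.2 : ZMod (p ^ 2)) = 1 := by
      have : (1 : ZMod (p ^ 2)) * u = y.2 * u := by rw [one_mul]; exact e1
      exact ((Units.mul_left_inj u).1 this).symm
    rw [e3, one_mul, add_eq_right, mul_iota, iota_eq_zero, mul_one] at e2
    exact hne e2
  have hred := (isUnit_iff_red _).1 hdet
  simp only [map_sub, map_mul, hγ, mul_zero, sub_zero] at hred
  obtain ⟨u, rfl⟩ := (isUnit_iff_red _).2 (left_ne_zero_of_mul hred)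
  obtain ⟨v, rfl⟩ := (isUnit_iff_red _).2 (right_ne_zero_of_mul hred)
  intro x hx
  obtain ⟨y, hy, c, h⟩ := key x hx 0
  have e1 := congrFun (congrFun h 0) 0
  have e2 := congrFun (congrFun h 1) 1
  simp [Matrix.mul_apply, mul_assoc, iota_mul, hγ] at e1 e2
  rw [mul_comm, Units.mul_left_inj] at e1
  rw [mul_comm, Units.mul_left_inj] at e2
  rwa [show x = y from Prod.ext (Units.ext e1) (Units.ext e2)]

lemma isNontriviallyLocallyConjugate_triSubgroup
    {E : Subgroup ((ZMod (p ^ 2))ˣ × (ZMod (p ^ 2))ˣ)} (h : E ≠ swapSubgroup E) :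
    IsNontriviallyLocallyConjugate (triSubgroup E) (triSubgroup (swapSubgroup E)) :=
  ⟨isLocallyConjugate_triSubgroup E, fun hc => h (le_antisymm
    (swapSubgroup_eq_of_isConjugateSubgroup hc)
    (swapSubgroup_eq_of_isConjugateSubgroup hc.symm))⟩

end

section

variable {p : ℕ} [Fact p.Prime]

/-- The subspace of matrices `A` with `1 + pA ∈ H`. -/
def kerSlice (H : Subgroup (GL2 (p ^ 2))) :
    Submodule (ZMod p) (Matrix (Fin 2) (Fin 2) (ZMod p)) where
  carrier := {A | kap A ∈ H}
  add_mem' {A B} hA hB := by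
    change kap (A + B) ∈ H
    rw [kap_add]
    exact H.mul_mem hA hB
  zero_mem' := by
    change kap 0 ∈ H
    rw [kap_zero]
    exact H.one_mem
  smul_mem' c A hA := kap_smul_mem hA c

lemma mem_kerSlice {H : Subgroup (GL2 (p ^ 2))} {A : Matrix (Fin 2) (Fin 2) (ZMod p)} :
    A ∈ kerSlice H ↔ kap A ∈ H := Iff.rfl

lemma conj_kap (g : GL2 (p ^ 2)) (A : Matrix (Fin 2) (Fin 2) (ZMod p)) :
    g * kap A * g⁻¹ = kap (conjEquiv (phi p g) A) := kap_conj g A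

lemma exists_kap_of_isConj {A : Matrix (Fin 2) (Fin 2) (ZMod p)} {h : GL2 (p ^ 2)}
    (hc : IsConj (kap A) h) : ∃ B, h = kap B := by
  obtain ⟨g, rfl⟩ := isConj_iff.1 hc
  exact ⟨_, conj_kap g A⟩

variable {H H₁ H₂ : Subgroup (GL2 (p ^ 2))}

lemma isLocConj_kerSlice (h : IsLocallyConjugate H₁ H₂) :
    IsLocConj (kerSlice H₁) (kerSlice H₂) := by
  obtain ⟨f, hf⟩ := h
  have h1 : ∀ A : kerSlice H₁, ∃ B : kerSlice H₂, (f ⟨kap A.1, A.2⟩ : GL2 (p ^ 2)) = kap B.1 := by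
    intro A
    obtain ⟨B, hB⟩ := exists_kap_of_isConj (hf ⟨kap A.1, A.2⟩)
    exact ⟨⟨B, by rw [mem_kerSlice, ← hB]; exact (f _).2⟩, hB⟩
  choose F hF using h1
  refine ⟨Equiv.ofBijective F ⟨fun A B hAB => ?_, fun B => ?_⟩, fun A => ?_⟩
  · have h2 := (hF A).trans ((congrArg (fun B => kap B.1) hAB).trans (hF B).symm)
    have h3 := f.injective (Subtype.ext h2)
    exact Subtype.ext (kap_injective (Subtype.ext_iff.1 h3))
  · have h2 := hf (f.symm ⟨kap B.1, B.2⟩)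
    rw [Equiv.apply_symm_apply] at h2
    obtain ⟨A, hA⟩ := exists_kap_of_isConj h2.symm
    have hA' : A ∈ kerSlice H₁ := by rw [mem_kerSlice, ← hA]; exact (f.symm _).2
    refine ⟨⟨A, hA'⟩, Subtype.ext (kap_injective ?_)⟩
    rw [← hF]
    have h3 : (⟨kap A, hA'⟩ : H₁) = f.symm ⟨kap B.1, B.2⟩ := Subtype.ext hA.symm
    simp [h3]
  · obtain ⟨g, hg⟩ := isConj_iff.1 (hf ⟨kap A.1, A.2⟩)
    refine ⟨phi p g, kap_injective ?_⟩
    rw [← conj_kap]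
    exact hg.trans (hF A)

lemma diagHom_self_comm (s : (ZMod (p ^ 2))ˣ) (g : GL2 (p ^ 2)) :
    g * diagHom p (s, s) = diagHom p (s, s) * g := by
  apply Units.ext
  rw [Units.val_mul, Units.val_mul, diagHom_val]
  ext i j
  fin_cases i <;> fin_cases j <;> simp [Matrix.mul_apply, mul_comm]

lemma conj_diagHom_self (s : (ZMod (p ^ 2))ˣ) (g : GL2 (p ^ 2)) :
    g * diagHom p (s, s) * g⁻¹ = diagHom p (s, s) := by
  rw [diagHom_self_comm, mul_inv_cancel_right]

lemma IsLocallyConjugate.diagHom_self_mem (h : IsLocallyConjugate H₁ H₂) {s : (ZMod (p ^ 2))ˣ}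
    (hs : diagHom p (s, s) ∈ H₁) : diagHom p (s, s) ∈ H₂ := by
  obtain ⟨f, hf⟩ := h
  obtain ⟨g, hg⟩ := isConj_iff.1 (hf ⟨_, hs⟩)
  rw [conj_diagHom_self] at hg
  rw [hg]
  exact (f _).2

lemma kap_pow_p (A : Matrix (Fin 2) (Fin 2) (ZMod p)) : kap A ^ p = 1 := by
  rw [← kap_nsmul]
  simp [kap_zero]

lemma diagHom_pow_p_mul_kap (s : (ZMod (p ^ 2))ˣ) (A : Matrix (Fin 2) (Fin 2) (ZMod p)) :
    (diagHom p (s, s) * kap A) ^ p = diagHom p (s ^ p, s ^ p) := by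
  have h : Commute (diagHom p (s, s)) (kap A) := (diagHom_self_comm s _).symm
  rw [h.mul_pow, kap_pow_p, mul_one, ← map_pow]
  rfl

lemma exists_eq_diagHom_mul_kap {h : GL2 (p ^ 2)} {x : (ZMod (p ^ 2))ˣ × (ZMod (p ^ 2))ˣ}
    (hx : phi p h = phi p (diagHom p x)) : ∃ A, h = diagHom p x * kap A := by
  have h1 : phi p ((diagHom p x)⁻¹ * h) = 1 := by rw [map_mul, map_inv, hx, inv_mul_cancel]
  obtain ⟨A, hA⟩ := exists_kap h1
  exact ⟨A, by rw [← hA, mul_inv_cancel_left]⟩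

lemma exists_phi_eq {h : GL2 (p ^ 2)} (hd : (phi p h).val.IsDiag) :
    ∃ x, phi p h = phi p (diagHom p x) := by
  have h1 := hd (show (0 : Fin 2) ≠ 1 by decide)
  have h2 := hd (show (1 : Fin 2) ≠ 0 by decide)
  have h3 := (Matrix.eta_fin_two (phi p h).val)
  rw [h1, h2] at h3
  have hdet := ((Matrix.isUnit_iff_isUnit_det _).1 (phi p h).isUnit).ne_zero
  rw [h3, Matrix.det_fin_two_of, mul_zero, sub_zero] at hdet
  obtain ⟨a, ha⟩ := red_surjective ((phi p h).val 0 0)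
  obtain ⟨d, hd⟩ := red_surjective ((phi p h).val 1 1)
  obtain ⟨u, rfl⟩ := (isUnit_iff_red _).2 (ha ▸ left_ne_zero_of_mul hdet)
  obtain ⟨v, rfl⟩ := (isUnit_iff_red _).2 (hd ▸ right_ne_zero_of_mul hdet)
  exact ⟨(u, v), Units.ext (by rw [phi_diagHom_val, h3, ha, hd])⟩

/-- Elements that are scalar modulo `p` split as a scalar times an element of the kernel. -/
lemma exists_scalar_mul_kap {h : GL2 (p ^ 2)} (hh : h ∈ H) (hd : (phi p h).val.IsDiag)
    (hs : (phi p h).val 0 0 = (phi p h).val 1 1) :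
    ∃ s A, diagHom p (s, s) ∈ H ∧ A ∈ kerSlice H ∧ h = diagHom p (s, s) * kap A := by
  obtain ⟨⟨u, v⟩, hx⟩ := exists_phi_eq hd
  have hv : (phi p (diagHom p (u, v))) = phi p (diagHom p (u, u)) := by
    rw [hx, phi_diagHom_val] at hs
    have h1 : red p u = red p v := by simpa using hs
    apply Units.ext
    rw [phi_diagHom_val, phi_diagHom_val, h1]
  obtain ⟨B, hB⟩ := exists_eq_diagHom_mul_kap (hx.trans hv)
  have h1 : diagHom p (u ^ p, u ^ p) ∈ H := by
    rw [← diagHom_pow_p_mul_kap u B, ← hB]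
    exact H.pow_mem hh _
  have h2 : phi p h = phi p (diagHom p (u ^ p, u ^ p)) := by
    rw [hx, hv]
    apply Units.ext
    rw [phi_diagHom_val, phi_diagHom_val]
    simp
  obtain ⟨A, hA⟩ := exists_eq_diagHom_mul_kap h2
  exact ⟨_, A, h1, (H.mul_mem_cancel_left h1).1 (hA ▸ hh), hA⟩

lemma conj_scalar_mul_kap (g : GL2 (p ^ 2)) (s : (ZMod (p ^ 2))ˣ)
    (A : Matrix (Fin 2) (Fin 2) (ZMod p)) :
    g * (diagHom p (s, s) * kap A) * g⁻¹ = diagHom p (s, s) * kap (conjEquiv (phi p g) A) := by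
  rw [← conj_kap, ← mul_assoc, diagHom_self_comm, mul_assoc, mul_assoc, mul_assoc]

lemma exists_conj_of_isSim {W : Submodule (ZMod p) (Matrix (Fin 2) (Fin 2) (ZMod p))}
    (hd : ∀ h ∈ H, (phi p h).val.IsDiag) (hs : ∀ h ∈ H, (phi p h).val 0 0 = (phi p h).val 1 1)
    (hW : IsSim (kerSlice H) W) :
    ∃ K, IsConjugateSubgroup H K ∧ ∀ g, g ∈ K ↔ ∃ s A, diagHom p (s, s) ∈ H ∧ A ∈ W ∧
      g = diagHom p (s, s) * kap A := by
  obtain ⟨g₀, hg₀⟩ := hW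
  obtain ⟨g, rfl⟩ := phi_surjective g₀
  refine ⟨_, isConjugateSubgroup_map g H, fun k => ⟨?_, ?_⟩⟩
  · rintro ⟨h, hh, rfl⟩
    obtain ⟨s, A, h1, h2, rfl⟩ := exists_scalar_mul_kap hh (hd h hh) (hs h hh)
    exact ⟨s, _, h1, hg₀ ▸ ⟨A, h2, rfl⟩, conj_scalar_mul_kap g s A⟩
  · rintro ⟨s, A, h1, h2, rfl⟩
    rw [← hg₀] at h2
    obtain ⟨B, hB, rfl⟩ := h2
    exact ⟨diagHom p (s, s) * kap B, H.mul_mem h1 hB, conj_scalar_mul_kap g s B⟩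

lemma kap_diag_val (a d : ZMod p) :
    (kap !![a, 0; 0, d]).val = !![1 + iota p a, 0; 0, 1 + iota p d] := by
  rw [kap_val]
  ext i j
  fin_cases i <;> fin_cases j <;> simp

lemma mem_borelPlane {a : ZMod p} {A : Matrix (Fin 2) (Fin 2) (ZMod p)} :
    A ∈ borelPlane a ↔ ∃ x y, A = !![y * (1 + a), x; 0, y * (1 - a)] := by
  rw [borelPlane, Submodule.mem_span_pair]
  refine exists_congr fun x => exists_congr fun y => ?_
  rw [eq_comm]
  simp

lemma conj_swapGL_kap (a b c d : ZMod p) :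
    swapGL p * kap !![a, b; c, d] * (swapGL p)⁻¹ = kap !![d, c; b, a] := by
  rw [mul_inv_eq_iff_eq_mul]
  apply Units.ext
  rw [Units.val_mul, Units.val_mul, kap_val, kap_val]
  ext i j
  fin_cases i <;> fin_cases j <;> simp [Matrix.mul_apply, swapGL]

lemma exists_tri_of_scalar (h2 : (2 : ZMod p) ≠ 0)
    (hd₁ : ∀ h ∈ H₁, (phi p h).val.IsDiag) (hd₂ : ∀ h ∈ H₂, (phi p h).val.IsDiag)
    (hs₁ : ∀ h ∈ H₁, (phi p h).val 0 0 = (phi p h).val 1 1)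
    (hs₂ : ∀ h ∈ H₂, (phi p h).val 0 0 = (phi p h).val 1 1)
    (h : IsNontriviallyLocallyConjugate H₁ H₂) :
    ∃ E, IsConjugateSubgroup H₁ (triSubgroup E) ∧
      IsConjugateSubgroup H₂ (triSubgroup (swapSubgroup E)) := by
  obtain ⟨hl, hn⟩ := h
  have hiff : ∀ s, diagHom p (s, s) ∈ H₂ ↔ diagHom p (s, s) ∈ H₁ :=
    fun s => ⟨hl.symm.diagHom_self_mem, hl.diagHom_self_mem⟩
  rcases isSim_or_isSim_borelPlane h2 (isLocConj_kerSlice hl) with ⟨g₀, hg₀⟩ | ⟨a, k₁, k₂⟩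
  · exfalso
    apply hn
    obtain ⟨g, rfl⟩ := phi_surjective g₀
    refine isConjugateSubgroup_of_forall_mem g hl.card_eq fun h hh => ?_
    obtain ⟨s, A, h1, h2, rfl⟩ := exists_scalar_mul_kap hh (hd₁ h hh) (hs₁ h hh)
    rw [conj_scalar_mul_kap]
    refine H₂.mul_mem ((hiff s).2 h1) ?_
    rw [← mem_kerSlice, ← hg₀]
    exact ⟨A, h2, rfl⟩
  · obtain ⟨K₁, c₁, m₁⟩ := exists_conj_of_isSim hd₁ hs₁ k₁
    obtain ⟨K₂, c₂, m₂⟩ := exists_conj_of_isSim hd₂ hs₂ k₂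
    simp only [hiff] at m₂
    have key : ∀ (K : Subgroup (GL2 (p ^ 2))) (a : ZMod p), (∀ g, g ∈ K ↔ ∃ s A,
        diagHom p (s, s) ∈ H₁ ∧ A ∈ borelPlane a ∧ g = diagHom p (s, s) * kap A) →
        K = triSubgroup (K.comap (diagHom p)) := by
      intro K a m
      apply eq_triSubgroup
      · refine (m _).2 ⟨1, _, ?_, mem_borelPlane.2 ⟨1, 0, rfl⟩, ?_⟩
        · rw [← Prod.one_eq_mk, map_one]
          exact H₁.one_mem
        · rw [← Prod.one_eq_mk, map_one]
          simp
      · intro g hg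
        obtain ⟨s, A, -, hA, rfl⟩ := (m g).1 hg
        obtain ⟨x, y, rfl⟩ := mem_borelPlane.1 hA
        obtain ⟨z, hz⟩ := exists_diagHom_val (kap_diag_val (y * (1 + a)) (y * (1 - a)))
        refine ⟨(s, s) * z, x, ?_⟩
        rw [map_mul, ← hz, mul_assoc, ← kap_add]
        simp
    have key' : ∀ (K K' : Subgroup (GL2 (p ^ 2))) (a : ZMod p), (∀ g, g ∈ K ↔ ∃ s A,
        diagHom p (s, s) ∈ H₁ ∧ A ∈ borelPlane a ∧ g = diagHom p (s, s) * kap A) →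
        (∀ g, g ∈ K' ↔ ∃ s A,
        diagHom p (s, s) ∈ H₁ ∧ A ∈ borelPlane (-a) ∧ g = diagHom p (s, s) * kap A) →
        ∀ x, diagHom p x ∈ K → diagHom p x.swap ∈ K' := by
      intro K K' a m m' x hx
      obtain ⟨s, A, hs, hA, hx⟩ := (m _).1 hx
      obtain ⟨b, y, rfl⟩ := mem_borelPlane.1 hA
      have hb : b = 0 := by
        have h1 := congrFun (congrFun (congrArg (fun g : GL2 (p ^ 2) => g.val) hx) 0) 1
        rw [Units.val_mul, diagHom_val, diagHom_val, kap_val] at h1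
        simp [Matrix.mul_apply] at h1
        exact (iota_eq_zero _).1 ((Units.mul_right_eq_zero s).1 h1.symm)
      refine (m' _).2 ⟨s, _, hs, mem_borelPlane.2 ⟨0, y, rfl⟩, ?_⟩
      rw [← conj_swapGL_diagHom, hx, hb, ← sub_eq_add_neg, sub_neg_eq_add,
        conj_scalar_mul_kap, ← conj_kap, conj_swapGL_kap]
    refine ⟨K₁.comap (diagHom p), key K₁ a m₁ ▸ c₁, ?_⟩
    have hsw : swapSubgroup (K₁.comap (diagHom p)) = K₂.comap (diagHom p) := by
      ext x
      refine ⟨fun hx => key' K₁ K₂ a m₁ m₂ x.swap hx,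
        fun hx => key' K₂ K₁ (-a) m₂ ((neg_neg a).symm ▸ m₁) x hx⟩
    rw [hsw]
    exact key K₂ (-a) m₂ ▸ c₂

end

section

/-- A subgroup whose elements outside `S` lie in `X ∪ Y` lies in `X` or in `Y`, as soon as it
meets `S` in elements whose `n`-th powers lie in `X ∩ Y`, with `n` odd. -/
lemma Subgroup.le_or_le_of_odd {A : Type*} [CommGroup A] {E X Y S : Subgroup A} {n : ℕ} (hn : Odd n)
    {x₀ : A} (hx₀ : x₀ ∈ E) (hx₀S : x₀ ∉ S) (hXY : ∀ x ∈ E, x ∉ S → x ∈ X ∨ x ∈ Y)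
    (hS : ∀ x ∈ E, x ∈ S → x ^ n ∈ X ∧ x ^ n ∈ Y) : E ≤ X ∨ E ≤ Y := by
  have gen : ∀ Z : Subgroup A, (∀ x ∈ E, x ∉ S → x ∈ Z) → E ≤ Z := by
    intro Z hZ x hx
    by_cases hxS : x ∈ S
    · have h1 : x₀ * x ∈ Z := hZ _ (E.mul_mem hx₀ hx)
        (fun h => hx₀S ((S.mul_mem_cancel_right hxS).1 h))
      exact (Z.mul_mem_cancel_left (hZ _ hx₀ hx₀S)).1 h1
    · exact hZ x hx hxS
  by_contra! hne
  obtain ⟨h, hE, hhS, hX⟩ : ∃ h ∈ E, h ∉ S ∧ h ∉ X := by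
    by_contra! hc
    exact hne.1 (gen X hc)
  obtain ⟨k, kE, kS, kY⟩ : ∃ k ∈ E, k ∉ S ∧ k ∉ Y := by
    by_contra! hc
    exact hne.2 (gen Y hc)
  have hY := (hXY h hE hhS).resolve_left hX
  have kX := (hXY k kE kS).resolve_right kY
  have hkS : h * k ∈ S := by
    by_contra hc
    rcases hXY _ (E.mul_mem hE kE) hc with h1 | h1
    · exact hX ((X.mul_mem_cancel_right kX).1 h1)
    · exact kY ((Y.mul_mem_cancel_left hY).1 h1)
  have hnX : h ^ n ∈ X := by
    have h1 := (hS _ (E.mul_mem hE kE) hkS).1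
    rw [mul_pow] at h1
    exact (X.mul_mem_cancel_right (X.pow_mem kX n)).1 h1
  rcases hXY (h * (h * k)) (E.mul_mem hE (E.mul_mem hE kE))
    (fun h1 => hhS ((S.mul_mem_cancel_right hkS).1 h1)) with h1 | h1
  · rw [← mul_assoc] at h1
    have h2 := (X.mul_mem_cancel_right kX).1 h1
    obtain ⟨m, rfl⟩ := hn
    rw [pow_succ, pow_mul, pow_two] at hnX
    exact hX ((X.mul_mem_cancel_left (X.pow_mem h2 m)).1 hnX)
  · exact kY ((Y.mul_mem_cancel_left hY).1 ((Y.mul_mem_cancel_left hY).1 h1))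

variable {p : ℕ} [Fact p.Prime] {H H₁ H₂ K K₁ K₂ : Subgroup (GL2 (p ^ 2))}

lemma kap_eq_mul (a b c d : ZMod p) :
    kap !![a, b; c, d] = kap !![a, 0; 0, d] * kap !![0, b; c, 0] := by
  rw [← kap_add]
  simp

lemma diagHom_mul_kap_off_val (x : (ZMod (p ^ 2))ˣ × (ZMod (p ^ 2))ˣ) (b c : ZMod p) :
    (diagHom p x * kap !![0, b; c, 0]).val =
      !![(x.1 : ZMod (p ^ 2)), x.1 * iota p b; x.2 * iota p c, x.2] := by
  rw [Units.val_mul, diagHom_val, kap_val]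
  ext i j
  fin_cases i <;> fin_cases j <;> simp [Matrix.mul_apply]

lemma diagHom_mul_kap_off_inj {x y : (ZMod (p ^ 2))ˣ × (ZMod (p ^ 2))ˣ} {b c b' c' : ZMod p}
    (h : diagHom p x * kap !![0, b; c, 0] = diagHom p y * kap !![0, b'; c', 0]) :
    x = y ∧ b = b' ∧ c = c' := by
  have h0 := congrArg (fun g : GL2 (p ^ 2) => g.val) h
  simp only [diagHom_mul_kap_off_val] at h0
  have e1 : (x.1 : ZMod (p ^ 2)) = y.1 := by simpa using congrFun (congrFun h0 0) 0
  have e2 : (x.2 : ZMod (p ^ 2)) = y.2 := by simpa using congrFun (congrFun h0 1) 1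
  have e3 : (x.1 : ZMod (p ^ 2)) * iota p b = y.1 * iota p b' := by
    simpa using congrFun (congrFun h0 0) 1
  have e4 : (x.2 : ZMod (p ^ 2)) * iota p c = y.2 * iota p c' := by
    simpa using congrFun (congrFun h0 1) 0
  rw [← e1, Units.mul_right_inj, iota_inj] at e3
  rw [← e2, Units.mul_right_inj, iota_inj] at e4
  exact ⟨Prod.ext (Units.ext e1) (Units.ext e2), e3, e4⟩

/-- Subgroups which are diagonal but not scalar modulo `p` and whose elements decompose inside
the subgroup as a diagonal matrix times an off-diagonal element of the kernel. -/
def IsSplit (K : Subgroup (GL2 (p ^ 2))) : Prop :=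
  (∃ x, diagHom p x ∈ K ∧ red p x.1 ≠ red p x.2) ∧ ∀ g ∈ K, ∃ x b c, diagHom p x ∈ K ∧
    kap !![0, b; c, 0] ∈ K ∧ g = diagHom p x * kap !![0, b; c, 0]

lemma exists_conj_diagHom_mem (hd : ∀ h ∈ H, (phi p h).val.IsDiag)
    (hs : ∃ h ∈ H, (phi p h).val 0 0 ≠ (phi p h).val 1 1) :
    ∃ K, IsConjugateSubgroup H K ∧ (∀ h ∈ K, (phi p h).val.IsDiag) ∧
      ∃ x, diagHom p x ∈ K ∧ red p x.1 ≠ red p x.2 := by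
  obtain ⟨h, hh, hne⟩ := hs
  obtain ⟨x, hx⟩ := exists_phi_eq (hd h hh)
  obtain ⟨A, hA⟩ := exists_eq_diagHom_mul_kap hx
  obtain ⟨a, b, c, d, rfl⟩ : ∃ a b c d, A = !![a, b; c, d] := ⟨_, _, _, _, Matrix.eta_fin_two A⟩
  rw [hx, phi_diagHom_val] at hne
  replace hne : red p x.1 ≠ red p x.2 := by simpa using hne
  have hx1 := red_unit_ne_zero x.1
  have hx2 := red_unit_ne_zero x.2
  set β := b * red p x.1 / (red p x.1 - red p x.2) with hβ
  set γ := c * red p x.2 / (red p x.2 - red p x.1) with hγ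
  have s1 := sub_ne_zero.2 hne
  have s2 := sub_ne_zero.2 hne.symm
  obtain ⟨z, hz⟩ := exists_diagHom_val (kap_diag_val a d)
  refine ⟨_, isConjugateSubgroup_map (kap !![0, β; γ, 0]) H, ?_, x * z, ⟨h, hh, ?_⟩, ?_⟩
  · rintro _ ⟨k, hk, rfl⟩
    have : phi p ((MulAut.conj (kap !![0, β; γ, 0])).toMonoidHom k) = phi p k := by
      change phi p (kap !![0, β; γ, 0] * k * (kap !![0, β; γ, 0])⁻¹) = _
      rw [map_mul, map_mul, map_inv, phi_kap]
      simp
    rw [this]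
    exact hd k hk
  · change kap !![0, β; γ, 0] * h * (kap !![0, β; γ, 0])⁻¹ = _
    rw [hA, ← mul_assoc, kap_mul_diagHom, mul_assoc, mul_assoc, ← kap_neg, ← kap_add, ← kap_add,
      map_mul, ← hz]
    congr 2
    ext i j
    fin_cases i <;> fin_cases j <;> simp
    · rw [hβ]
      field_simp
      ring
    · rw [hγ]
      field_simp
      ring
  · have h1 : phi p (diagHom p z) = 1 := by rw [← hz, phi_kap]
    have h2 := phi_diagHom_val z
    rw [h1] at h2
    have e1 : 1 = red p z.1 := by simpa using congrFun (congrFun h2 0) 0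
    have e2 : 1 = red p z.2 := by simpa using congrFun (congrFun h2 1) 1
    simpa [← e1, ← e2] using hne

lemma isSplit_of_diagHom_mem (hd : ∀ h ∈ K, (phi p h).val.IsDiag)
    (hx : ∃ x, diagHom p x ∈ K ∧ red p x.1 ≠ red p x.2) : IsSplit K := by
  refine ⟨hx, fun g hg => ?_⟩
  obtain ⟨x, hx, hne⟩ := hx
  obtain ⟨y, hy⟩ := exists_phi_eq (hd g hg)
  obtain ⟨A, hA⟩ := exists_eq_diagHom_mul_kap hy
  obtain ⟨a, b, c, d, rfl⟩ : ∃ a b c d, A = !![a, b; c, d] := ⟨_, _, _, _, Matrix.eta_fin_two A⟩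
  obtain ⟨z, hz⟩ := exists_diagHom_val (kap_diag_val a d)
  rw [kap_eq_mul, hz, ← mul_assoc, ← map_mul] at hA
  suffices h : kap !![0, b; c, 0] ∈ K by
    exact ⟨y * z, b, c, (K.mul_mem_cancel_right h).1 (hA ▸ hg), h, hA⟩
  have hx1 := red_unit_ne_zero x.1
  have hx2 := red_unit_ne_zero x.2
  obtain ⟨r, hr⟩ : ∃ r, r = red p x.1 / red p x.2 := ⟨_, rfl⟩
  have hr' : red p x.2 / red p x.1 = r⁻¹ := by rw [hr, inv_div]
  have hr0 : r ≠ 0 := by rw [hr]; exact div_ne_zero hx1 hx2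
  have hr1 : r - 1 ≠ 0 := by
    rw [hr, sub_ne_zero]
    intro h
    exact hne ((div_eq_one_iff_eq hx2).1 h)
  have hc : ∀ b c, diagHom p x * kap !![0, b; c, 0] * (diagHom p x)⁻¹ =
      kap !![0, r * b; r⁻¹ * c, 0] := by
    intro b c
    rw [diagHom_conj_kap, hr', ← hr]
  have hxy : diagHom p x * diagHom p (y * z) * (diagHom p x)⁻¹ = diagHom p (y * z) := by
    rw [← map_mul, mul_comm, map_mul, mul_inv_cancel_right]
  have h1 : kap !![0, (r - 1) * b; (r⁻¹ - 1) * c, 0] ∈ K := by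
    have h2 : g⁻¹ * (diagHom p x * g * (diagHom p x)⁻¹) ∈ K :=
      K.mul_mem (K.inv_mem hg) (K.mul_mem (K.mul_mem hx hg) (K.inv_mem hx))
    have h3 : diagHom p x * g * (diagHom p x)⁻¹ =
        diagHom p (y * z) * kap !![0, r * b; r⁻¹ * c, 0] := by
      rw [← hc, hA]
      conv_rhs => rw [← hxy]
      group
    rw [h3, hA] at h2
    convert h2 using 1
    have h4 : !![0, (r - 1) * b; (r⁻¹ - 1) * c, 0] = -!![0, b; c, 0] + !![0, r * b; r⁻¹ * c, 0] := by
      ext i j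
      fin_cases i <;> fin_cases j <;> simp <;> ring
    rw [h4, kap_add, kap_neg]
    group
  have h2 : kap !![0, r * ((r - 1) * b); r⁻¹ * ((r⁻¹ - 1) * c), 0] ∈ K := by
    rw [← hc]
    exact K.mul_mem (K.mul_mem hx h1) (K.inv_mem hx)
  have h3 := (kerSlice K).add_mem
    ((kerSlice K).smul_mem ((1 - r ^ 2 / (r - 1)) / (r - 1)) (mem_kerSlice.2 h1))
    ((kerSlice K).smul_mem (r / (r - 1) ^ 2) (mem_kerSlice.2 h2))
  rw [mem_kerSlice] at h3
  convert h3 using 2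
  ext i j
  fin_cases i <;> fin_cases j <;> simp <;> field_simp <;> ring

lemma IsSplit.mem_or_mem (hK : IsSplit K) {x : (ZMod (p ^ 2))ˣ × (ZMod (p ^ 2))ˣ}
    (hx : red p x.1 ≠ red p x.2) {g : GL2 (p ^ 2)} (hg : g ∈ K) (hc : IsConj (diagHom p x) g) :
    diagHom p x ∈ K ∨ diagHom p x.swap ∈ K := by
  obtain ⟨z, b, c, hz, -, rfl⟩ := hK.2 g hg
  obtain ⟨k, hk⟩ := isConj_iff.1 hc
  have hk' : (k * diagHom p x * k⁻¹).val = (diagHom p z * kap !![0, b; c, 0]).val := by rw [hk]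
  rw [diagHom_mul_kap_off_val, Units.val_mul, Units.val_mul] at hk'
  have ht := congrArg Matrix.trace hk'
  have hdet := congrArg Matrix.det hk'
  rw [Matrix.trace_mul_comm, ← mul_assoc, ← Units.val_mul, inv_mul_cancel, Units.val_one, one_mul,
    diagHom_val, Matrix.trace_fin_two_of, Matrix.trace_fin_two_of] at ht
  rw [Matrix.det_mul_comm, ← mul_assoc, ← Units.val_mul, inv_mul_cancel, Units.val_one, one_mul,
    diagHom_val, Matrix.det_fin_two_of, Matrix.det_fin_two_of] at hdet
  have hd : (x.1 * x.2 : ZMod (p ^ 2)) = z.1 * z.2 := by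
    linear_combination hdet - z.1 * z.2 * iota_mul_iota b c
  have hp : (x.1 - z.1 : ZMod (p ^ 2)) * (x.1 - z.2) = 0 := by
    linear_combination (x.1 : ZMod (p ^ 2)) * ht - hd
  by_cases h1 : red p (x.1 - z.1) = 0
  · left
    have h2 : IsUnit (x.1 - z.2 : ZMod (p ^ 2)) := by
      rw [isUnit_iff_red]
      intro h2
      have h3 := congrArg (red p) ht
      simp only [map_add, map_sub] at h1 h2 h3
      exact hx (by linear_combination h1 + h2 - h3)
    rw [h2.mul_left_eq_zero] at hp
    have e1 : (x.1 : ZMod (p ^ 2)) = z.1 := by linear_combination hp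
    have e2 : (x.2 : ZMod (p ^ 2)) = z.2 := by linear_combination ht - hp
    rwa [show x = z from Prod.ext (Units.ext e1) (Units.ext e2)]
  · right
    rw [((isUnit_iff_red _).2 h1).mul_right_eq_zero] at hp
    have e1 : (x.1 : ZMod (p ^ 2)) = z.2 := by linear_combination hp
    have e2 : (x.2 : ZMod (p ^ 2)) = z.1 := by linear_combination ht - hp
    rwa [show x.swap = z from Prod.ext (Units.ext e2) (Units.ext e1)]

lemma IsSplit.comap_le_or_le (hp : Odd p) (h₁ : IsSplit K₁) (h₂ : IsSplit K₂)
    (hl : IsLocallyConjugate K₁ K₂) : K₁.comap (diagHom p) ≤ K₂.comap (diagHom p) ∨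
      K₁.comap (diagHom p) ≤ swapSubgroup (K₂.comap (diagHom p)) := by
  let S : Subgroup ((ZMod (p ^ 2))ˣ × (ZMod (p ^ 2))ˣ) := MonoidHom.eqLocus
    ((Units.map (red p : ZMod (p ^ 2) →* ZMod p)).comp (MonoidHom.fst _ _))
    ((Units.map (red p : ZMod (p ^ 2) →* ZMod p)).comp (MonoidHom.snd _ _))
  have hS : ∀ x, x ∈ S ↔ red p x.1 = red p x.2 := fun x => Units.ext_iff
  obtain ⟨x₀, hx₀, hne⟩ := h₁.1
  refine Subgroup.le_or_le_of_odd (S := S) hp (x₀ := x₀) hx₀ ?_ ?_ ?_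
  · rwa [hS]
  · intro x hx hxS
    rw [hS] at hxS
    obtain ⟨f, hf⟩ := hl
    exact h₂.mem_or_mem hxS (f _).2 (hf ⟨_, hx⟩)
  · intro x hx hxS
    rw [hS] at hxS
    have h1 : x ^ p = (x.1 ^ p, x.1 ^ p) :=
      Prod.ext rfl (Units.ext (by simpa using (pow_eq_of_red_eq hxS).symm))
    have h2 : diagHom p (x.1 ^ p, x.1 ^ p) ∈ K₁ := by
      rw [← h1, map_pow]
      exact K₁.pow_mem hx p
    have h3 := hl.diagHom_self_mem h2
    rw [h1]
    exact ⟨h3, h3⟩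

lemma card_swapSubgroup (E : Subgroup ((ZMod (p ^ 2))ˣ × (ZMod (p ^ 2))ˣ)) :
    Nat.card (swapSubgroup E) = Nat.card E :=
  Nat.card_congr ((Equiv.prodComm _ _).subtypeEquiv fun _ => Iff.rfl)

lemma IsSplit.comap_eq_or_eq (hp : Odd p) (h₁ : IsSplit K₁) (h₂ : IsSplit K₂)
    (hl : IsLocallyConjugate K₁ K₂) : K₁.comap (diagHom p) = K₂.comap (diagHom p) ∨
      K₁.comap (diagHom p) = swapSubgroup (K₂.comap (diagHom p)) := by
  have hle : ∀ {E E' : Subgroup ((ZMod (p ^ 2))ˣ × (ZMod (p ^ 2))ˣ)},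
      E ≤ E' ∨ E ≤ swapSubgroup E' → Nat.card E ≤ Nat.card E' := by
    rintro E E' (h | h)
    · exact Subgroup.card_le_of_le h
    · exact (Subgroup.card_le_of_le h).trans (card_swapSubgroup E').le
  have h3 := hle (h₂.comap_le_or_le hp h₁ hl.symm)
  exact (h₁.comap_le_or_le hp h₂ hl).imp (fun h => Subgroup.eq_of_le_of_card_ge h h3)
    (fun h => Subgroup.eq_of_le_of_card_ge h ((card_swapSubgroup _).le.trans h3))

end

section

variable {p : ℕ} [Fact p.Prime] {H₁ H₂ K K₁ K₂ : Subgroup (GL2 (p ^ 2))}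

/-- The space of off-diagonal parts of the kernel of `K`. -/
def offSlice (K : Subgroup (GL2 (p ^ 2))) : Submodule (ZMod p) (ZMod p × ZMod p) where
  carrier := {v | kap !![0, v.1; v.2, 0] ∈ K}
  add_mem' {v w} hv hw := by
    have : !![0, (v + w).1; (v + w).2, 0] = !![0, v.1; v.2, 0] + !![0, w.1; w.2, 0] := by simp
    change kap !![0, (v + w).1; (v + w).2, 0] ∈ K
    rw [this, kap_add]
    exact K.mul_mem hv hw
  zero_mem' := by
    have : !![0, 0; 0, 0] = (0 : Matrix (Fin 2) (Fin 2) (ZMod p)) := (Matrix.eta_fin_two 0).symm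
    change kap !![0, 0; 0, 0] ∈ K
    rw [this, kap_zero]
    exact K.one_mem
  smul_mem' k v hv := by
    have : !![0, (k • v).1; (k • v).2, 0] = k • !![0, v.1; v.2, 0] := by simp
    change kap !![0, (k • v).1; (k • v).2, 0] ∈ K
    rw [this]
    exact kap_smul_mem hv k

lemma mem_offSlice {b c : ZMod p} : (b, c) ∈ offSlice K ↔ kap !![0, b; c, 0] ∈ K := Iff.rfl

lemma IsSplit.card_eq (h : IsSplit K) :
    Nat.card K = Nat.card (K.comap (diagHom p)) * Nat.card (offSlice K) := by
  rw [← Nat.card_prod]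
  symm
  refine Nat.card_congr (Equiv.ofBijective
    (fun y => ⟨diagHom p y.1.1 * kap !![0, y.2.1.1; y.2.1.2, 0], K.mul_mem y.1.2 y.2.2⟩) ⟨?_, ?_⟩)
  · rintro ⟨⟨x, hx⟩, ⟨⟨b, c⟩, hv⟩⟩ ⟨⟨y, hy⟩, ⟨⟨b', c'⟩, hw⟩⟩ h0
    obtain ⟨(rfl : x = y), (rfl : b = b'), (rfl : c = c')⟩ :=
      diagHom_mul_kap_off_inj (Subtype.ext_iff.1 h0)
    rfl
  · rintro ⟨g, hg⟩
    obtain ⟨x, b, c, hx, hv, rfl⟩ := h.2 g hg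
    exact ⟨(⟨x, hx⟩, ⟨(b, c), hv⟩), rfl⟩

lemma IsSplit.mem_kerSlice (h : IsSplit K) {a b c d : ZMod p} :
    !![a, b; c, d] ∈ kerSlice K ↔ !![a, 0; 0, d] ∈ kerSlice K ∧ (b, c) ∈ offSlice K := by
  rw [_root_.mem_kerSlice, _root_.mem_kerSlice, mem_offSlice, kap_eq_mul]
  constructor
  · intro hm
    obtain ⟨z, hz⟩ := exists_diagHom_val (kap_diag_val a d)
    obtain ⟨x, b', c', hx, hv, he⟩ := h.2 _ hm
    rw [hz] at he
    obtain ⟨rfl, rfl, rfl⟩ := diagHom_mul_kap_off_inj he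
    exact ⟨hz ▸ hx, hv⟩
  · exact fun hm => K.mul_mem hm.1 hm.2

lemma diag_mem_kerSlice_congr (hE : K₁.comap (diagHom p) = K₂.comap (diagHom p)) (a d : ZMod p) :
    !![a, 0; 0, d] ∈ kerSlice K₁ ↔ !![a, 0; 0, d] ∈ kerSlice K₂ := by
  obtain ⟨z, hz⟩ := exists_diagHom_val (kap_diag_val a d)
  rw [mem_kerSlice, mem_kerSlice, hz, ← Subgroup.mem_comap, hE, Subgroup.mem_comap]

lemma IsSplit.isConjugateSubgroup (h₁ : IsSplit K₁)
    (hE : K₁.comap (diagHom p) = K₂.comap (diagHom p)) (hc : Nat.card K₁ = Nat.card K₂)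
    {l : ZMod p} (hl : l ≠ 0)
    (h : ∀ b c, (b, c) ∈ offSlice K₁ → (l * b, l⁻¹ * c) ∈ offSlice K₂) :
    IsConjugateSubgroup K₁ K₂ := by
  obtain ⟨u, rfl⟩ := red_surjective l
  obtain ⟨u, rfl⟩ := (isUnit_iff_red _).2 hl
  refine isConjugateSubgroup_of_forall_mem (diagHom p (u, 1)) hc fun g hg => ?_
  obtain ⟨x, b, c, hx, hv, rfl⟩ := h₁.2 g hg
  have h1 := diagHom_conj_kap (u, 1) 0 b c 0
  simp only [Units.val_one, map_one, div_one, one_div] at h1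
  have h2 : diagHom p (u, 1) * diagHom p x = diagHom p x * diagHom p (u, 1) := by
    rw [← map_mul, mul_comm, map_mul]
  rw [← mul_assoc, h2, mul_assoc, mul_assoc, ← mul_assoc (diagHom p (u, 1)), h1]
  refine K₂.mul_mem ?_ (h b c hv)
  rwa [← Subgroup.mem_comap, ← hE]

/-- An invariant of a line of off-diagonal matrices in a space of matrices. -/
lemma IsConjInto.exists_sq_mul_eq
    {V₁ V₂ : Submodule (ZMod p) (Matrix (Fin 2) (Fin 2) (ZMod p))} (h : IsConjInto V₁ V₂)
    {β₁ γ₁ β₂ γ₂ : ZMod p} (h₁ : !![0, β₁; γ₁, 0] ∈ V₁) (h0 : (β₁, γ₁) ≠ 0)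
    (h₂ : ∀ a b c, !![a, b; c, -a] ∈ V₂ → a = 0 ∧ ∃ s, b = s * β₂ ∧ c = s * γ₂) :
    ∃ t, t ≠ 0 ∧ β₁ * γ₁ = t ^ 2 * (β₂ * γ₂) := by
  obtain ⟨g, hg⟩ := h _ h₁
  have htr := trace_conjEquiv g !![0, β₁; γ₁, 0]
  have hdet := det_conjEquiv g !![0, β₁; γ₁, 0]
  obtain ⟨a, b, c, d, hB⟩ : ∃ a b c d, conjEquiv g !![0, β₁; γ₁, 0] = !![a, b; c, d] :=
    ⟨_, _, _, _, Matrix.eta_fin_two _⟩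
  rw [hB, Matrix.trace_fin_two_of, Matrix.trace_fin_two_of] at htr
  obtain rfl : d = -a := by linear_combination htr
  rw [hB] at hg
  obtain ⟨rfl, t, rfl, rfl⟩ := h₂ _ _ _ hg
  rw [hB, Matrix.det_fin_two_of, Matrix.det_fin_two_of] at hdet
  refine ⟨t, ?_, by linear_combination hdet⟩
  rintro rfl
  have h3 : conjEquiv g !![0, β₁; γ₁, 0] = 0 := by
    rw [hB]
    ext i j
    fin_cases i <;> fin_cases j <;> simp
  rw [map_eq_zero_iff _ (conjEquiv g).injective] at h3
  apply h0
  have e1 := congrFun (congrFun h3 0) 1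
  have e2 := congrFun (congrFun h3 1) 0
  exact Prod.ext (by simpa using e1) (by simpa using e2)

lemma exists_eq_mul_of_mul_eq {β γ b c : ZMod p} (h0 : (β, γ) ≠ 0) (h : b * γ = c * β) :
    ∃ s, b = s * β ∧ c = s * γ := by
  by_cases hβ : β = 0
  · have hγ : γ ≠ 0 := fun hγ => h0 (by simp [hβ, hγ])
    refine ⟨c / γ, ?_, by field_simp⟩
    rw [hβ, mul_zero] at h ⊢
    exact (mul_eq_zero.1 h).resolve_right hγ
  · refine ⟨b / β, by field_simp, ?_⟩
    field_simp
    exact h.symm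

lemma IsLocConj.exists_sq_mul_eq (h2 : (2 : ZMod p) ≠ 0)
    {W₁ W₂ : Submodule (ZMod p) (Matrix (Fin 2) (Fin 2) (ZMod p))} (h : IsLocConj W₁ W₂)
    (hP : ∀ a d, !![a, 0; 0, d] ∈ W₁ ↔ !![a, 0; 0, d] ∈ W₂)
    {β₁ γ₁ β₂ γ₂ : ZMod p} (h₁ : (β₁, γ₁) ≠ 0) (h₂ : (β₂, γ₂) ≠ 0)
    (m₁ : ∀ a b c d, !![a, b; c, d] ∈ W₁ ↔
      !![a, 0; 0, d] ∈ W₁ ∧ ∃ s, b = s * β₁ ∧ c = s * γ₁)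
    (m₂ : ∀ a b c d, !![a, b; c, d] ∈ W₂ ↔
      !![a, 0; 0, d] ∈ W₂ ∧ ∃ s, b = s * β₂ ∧ c = s * γ₂) :
    ∃ t, t ≠ 0 ∧ β₁ * γ₁ = t ^ 2 * (β₂ * γ₂) := by
  have hz : !![0, 0; 0, 0] = (0 : Matrix (Fin 2) (Fin 2) (ZMod p)) := (Matrix.eta_fin_two 0).symm
  have o₁ : !![0, β₁; γ₁, 0] ∈ W₁ := by
    rw [m₁, hz]
    exact ⟨W₁.zero_mem, 1, by simp⟩
  have o₂ : !![0, β₂; γ₂, 0] ∈ W₂ := by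
    rw [m₂, hz]
    exact ⟨W₂.zero_mem, 1, by simp⟩
  by_cases hd : !![1, 0; 0, -1] ∈ W₁
  · suffices ∃ t, t ≠ 0 ∧ β₁ * -γ₁ = t ^ 2 * (β₂ * -γ₂) by
      obtain ⟨t, ht, he⟩ := this
      exact ⟨t, ht, by linear_combination -he⟩
    refine h.orthogonal.exists_sq_mul_eq ?_ ?_ ?_
    · intro A hA
      obtain ⟨a, b, c, d, rfl⟩ : ∃ a b c d, A = !![a, b; c, d] := ⟨_, _, _, _, Matrix.eta_fin_two A⟩
      obtain ⟨-, s, rfl, rfl⟩ := (m₁ _ _ _ _).1 hA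
      change tracePairing p _ _ = 0
      rw [tracePairing_apply]
      simp [Matrix.trace_fin_two]
      ring
    · simpa using h₁
    · intro a b c hX
      have e1 : tracePairing p _ _ = 0 := hX _ ((hP 1 (-1)).1 hd)
      have e2 : tracePairing p _ _ = 0 := hX _ o₂
      rw [tracePairing_apply] at e1 e2
      simp [Matrix.trace_fin_two] at e1 e2
      constructor
      · apply mul_left_cancel₀ h2
        linear_combination e1
      · exact exists_eq_mul_of_mul_eq (by simpa using h₂) (by linear_combination -e2)
  · refine h.isConjInto.exists_sq_mul_eq o₁ h₁ fun a b c hX => ?_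
    obtain ⟨h3, h4⟩ := (m₂ _ _ _ _).1 hX
    refine ⟨?_, h4⟩
    by_contra ha
    apply hd
    rw [hP]
    convert W₂.smul_mem a⁻¹ h3 using 1
    ext i j
    fin_cases i <;> fin_cases j <;> simp [ha]

lemma mem_map_conj_swapGL {g : GL2 (p ^ 2)} :
    g ∈ K.map (MulAut.conj (swapGL p)).toMonoidHom ↔ swapGL p * g * (swapGL p)⁻¹ ∈ K := by
  have hs : swapGL p * swapGL p = 1 := (swapGL p).val_inv |> fun h => Units.ext h
  constructor
  · rintro ⟨k, hk, rfl⟩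
    have hk' : swapGL p * (swapGL p * k * swapGL p) * swapGL p = k := by
      simp only [mul_assoc, hs, mul_one]
      rw [← mul_assoc, hs, one_mul]
    change swapGL p * (swapGL p * k * swapGL p) * swapGL p ∈ K
    rwa [hk']
  · intro h
    refine ⟨_, h, ?_⟩
    change swapGL p * (swapGL p * g * swapGL p) * swapGL p = g
    simp only [mul_assoc, hs, mul_one]
    rw [← mul_assoc, hs, one_mul]

lemma comap_map_conj_swapGL (K : Subgroup (GL2 (p ^ 2))) :
    (K.map (MulAut.conj (swapGL p)).toMonoidHom).comap (diagHom p) =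
      swapSubgroup (K.comap (diagHom p)) := by
  ext x
  rw [Subgroup.mem_comap, mem_map_conj_swapGL, conj_swapGL_diagHom]
  rfl

lemma mem_offSlice_map_conj_swapGL {b c : ZMod p} :
    (b, c) ∈ offSlice (K.map (MulAut.conj (swapGL p)).toMonoidHom) ↔ (c, b) ∈ offSlice K := by
  rw [mem_offSlice, mem_map_conj_swapGL, conj_swapGL_kap]
  rfl

lemma IsSplit.map_conj_swapGL (h : IsSplit K) :
    IsSplit (K.map (MulAut.conj (swapGL p)).toMonoidHom) := by
  constructor
  · obtain ⟨x, hx, hne⟩ := h.1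
    exact ⟨x.swap, ⟨_, hx, conj_swapGL_diagHom x⟩, hne.symm⟩
  · rintro _ ⟨g, hg, rfl⟩
    obtain ⟨x, b, c, hx, hv, rfl⟩ := h.2 g hg
    refine ⟨x.swap, c, b, ⟨_, hx, conj_swapGL_diagHom x⟩, ⟨_, hv, conj_swapGL_kap 0 b c 0⟩, ?_⟩
    rw [map_mul]
    exact congrArg₂ (· * ·) (conj_swapGL_diagHom x) (conj_swapGL_kap 0 b c 0)

lemma IsSplit.eq_triSubgroup (h : IsSplit K) (h1 : (1, 0) ∈ offSlice K)
    (h0 : ∀ b c, (b, c) ∈ offSlice K → c = 0) : K = triSubgroup (K.comap (diagHom p)) := by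
  refine _root_.eq_triSubgroup h1 fun g hg => ?_
  obtain ⟨x, b, c, -, hv, rfl⟩ := h.2 g hg
  obtain rfl := h0 b c hv
  exact ⟨x, b, rfl⟩

lemma IsSplit.exists_tri_of_offSlice (h₁ : IsSplit K₁) (h₂ : IsSplit K₂)
    (hE : K₁.comap (diagHom p) = K₂.comap (diagHom p))
    (m₁ : ∀ b c, (b, c) ∈ offSlice K₁ ↔ c = 0) (m₂ : ∀ b c, (b, c) ∈ offSlice K₂ ↔ b = 0) :
    ∃ E, IsConjugateSubgroup K₁ (triSubgroup E) ∧
      IsConjugateSubgroup K₂ (triSubgroup (swapSubgroup E)) := by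
  have e₁ := h₁.eq_triSubgroup ((m₁ 1 0).2 rfl) fun b c h => (m₁ b c).1 h
  have e₂ := h₂.map_conj_swapGL.eq_triSubgroup
    (mem_offSlice_map_conj_swapGL.2 ((m₂ 0 1).2 rfl))
    fun b c h => (m₂ c b).1 (mem_offSlice_map_conj_swapGL.1 h)
  rw [comap_map_conj_swapGL, ← hE] at e₂
  refine ⟨K₁.comap (diagHom p), ?_, swapGL p, e₂⟩
  rw [← e₁]
  exact ⟨1, by ext; simp⟩

lemma exists_mem_offSlice_iff (hK : Module.finrank (ZMod p) (offSlice K) = 1) :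
    ∃ β γ, (β, γ) ≠ 0 ∧ ∀ b c, (b, c) ∈ offSlice K ↔ ∃ s, b = s * β ∧ c = s * γ := by
  generalize offSlice K = V at hK ⊢
  obtain ⟨v, hv0, hs⟩ := finrank_eq_one_iff'.1 hK
  refine ⟨v.1.1, v.1.2, fun h => hv0 (Subtype.ext h), fun b c => ⟨fun hbc => ?_, ?_⟩⟩
  · obtain ⟨s, hs⟩ := hs ⟨(b, c), hbc⟩
    have e : s • v.1 = (b, c) := congrArg Subtype.val hs
    exact ⟨s, (congrArg Prod.fst e).symm, (congrArg Prod.snd e).symm⟩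
  · rintro ⟨s, rfl, rfl⟩
    exact V.smul_mem s v.2

lemma line_eq_left_axis {β γ b c : ZMod p} (hz : (β, γ) ≠ 0) (h0 : γ = 0) :
    (∃ s, b = s * β ∧ c = s * γ) ↔ c = 0 := by
  subst h0
  have hβ : β ≠ 0 := fun h => hz (by simp [h])
  exact ⟨fun ⟨s, _, h⟩ => by simpa using h, fun h => ⟨b / β, by field_simp, by simpa using h⟩⟩

lemma line_eq_right_axis {β γ b c : ZMod p} (hz : (β, γ) ≠ 0) (h0 : β = 0) :
    (∃ s, b = s * β ∧ c = s * γ) ↔ b = 0 := by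
  subst h0
  have hγ : γ ≠ 0 := fun h => hz (by simp [h])
  exact ⟨fun ⟨s, h, _⟩ => by simpa using h, fun h => ⟨c / γ, by simpa using h, by field_simp⟩⟩

lemma IsSplit.exists_tri_of_comap_eq (h2 : (2 : ZMod p) ≠ 0) (h₁ : IsSplit K₁) (h₂ : IsSplit K₂)
    (hE : K₁.comap (diagHom p) = K₂.comap (diagHom p))
    (h : IsNontriviallyLocallyConjugate K₁ K₂) :
    ∃ E, IsConjugateSubgroup K₁ (triSubgroup E) ∧
      IsConjugateSubgroup K₂ (triSubgroup (swapSubgroup E)) := by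
  obtain ⟨hl, hn⟩ := h
  have hno : ∀ l : ZMod p, l ≠ 0 →
      ¬ ∀ b c, (b, c) ∈ offSlice K₁ → (l * b, l⁻¹ * c) ∈ offSlice K₂ :=
    fun l hl0 hf => hn (h₁.isConjugateSubgroup hE hl.card_eq hl0 hf)
  have hcard : Nat.card (offSlice K₁) = Nat.card (offSlice K₂) := by
    have h3 := hl.card_eq
    rw [h₁.card_eq, h₂.card_eq, hE] at h3
    exact Nat.eq_of_mul_eq_mul_left Nat.card_pos h3
  have hr : Module.finrank (ZMod p) (offSlice K₁) = Module.finrank (ZMod p) (offSlice K₂) := by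
    rw [Module.natCard_eq_pow_finrank (K := ZMod p) (V := offSlice K₁),
      Module.natCard_eq_pow_finrank (K := ZMod p) (V := offSlice K₂), Nat.card_zmod] at hcard
    exact Nat.pow_right_injective ((Fact.out : p.Prime).two_le) hcard
  have hr2 : Module.finrank (ZMod p) (ZMod p × ZMod p) = 2 := by simp
  have hle := Submodule.finrank_le (offSlice K₁)
  rw [hr2] at hle
  have hne : offSlice K₁ ≠ offSlice K₂ := by
    intro he
    refine hno 1 one_ne_zero fun b c hbc => ?_
    rw [← he]
    simpa using hbc
  have hr1 : Module.finrank (ZMod p) (offSlice K₁) = 1 := by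
    by_contra hr1
    apply hne
    rcases (by omega : Module.finrank (ZMod p) (offSlice K₁) = 0 ∨
      Module.finrank (ZMod p) (offSlice K₁) = 2) with h0 | h0
    · rw [Submodule.finrank_eq_zero.1 h0, Submodule.finrank_eq_zero.1 (hr.symm.trans h0)]
    · rw [Submodule.eq_top_of_finrank_eq (h0.trans hr2.symm),
        Submodule.eq_top_of_finrank_eq ((hr.symm.trans h0).trans hr2.symm)]
  obtain ⟨β₁, γ₁, z₁, m₁⟩ := exists_mem_offSlice_iff hr1
  obtain ⟨β₂, γ₂, z₂, m₂⟩ := exists_mem_offSlice_iff (hr.symm.trans hr1)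
  obtain ⟨t, ht, hq⟩ := (isLocConj_kerSlice hl).exists_sq_mul_eq h2 (diag_mem_kerSlice_congr hE)
    z₁ z₂ (fun a b c d => h₁.mem_kerSlice.trans (and_congr Iff.rfl (m₁ b c)))
    (fun a b c d => h₂.mem_kerSlice.trans (and_congr Iff.rfl (m₂ b c)))
  have hno' : ∀ l s : ZMod p, l ≠ 0 → l * β₁ = s * β₂ → l⁻¹ * γ₁ = s * γ₂ → False := by
    intro l s hl0 e1 e2
    refine hno l hl0 fun b c hbc => ?_
    obtain ⟨r, rfl, rfl⟩ := (m₁ _ _).1 hbc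
    exact (m₂ _ _).2 ⟨r * s, by linear_combination r * e1, by linear_combination r * e2⟩
  by_cases hq₂ : β₂ * γ₂ = 0
  · rw [hq₂, mul_zero] at hq
    rcases mul_eq_zero.1 hq with k₁ | k₁ <;> rcases mul_eq_zero.1 hq₂ with k₂ | k₂
    · have hγ : γ₂ ≠ 0 := fun h => z₂ (by simp [k₂, h])
      exact (hno' 1 (γ₁ / γ₂) one_ne_zero (by simp [k₁, k₂]) (by field_simp)).elim
    · obtain ⟨E, hE₂, hE₁⟩ := h₂.exists_tri_of_offSlice h₁ hE.symm
        (fun b c => (m₂ b c).trans (line_eq_left_axis z₂ k₂))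
        (fun b c => (m₁ b c).trans (line_eq_right_axis z₁ k₁))
      exact ⟨swapSubgroup E, hE₁, by rwa [swapSubgroup_swapSubgroup]⟩
    · exact h₁.exists_tri_of_offSlice h₂ hE
        (fun b c => (m₁ b c).trans (line_eq_left_axis z₁ k₁))
        (fun b c => (m₂ b c).trans (line_eq_right_axis z₂ k₂))
    · have hβ : β₂ ≠ 0 := fun h => z₂ (by simp [k₂, h])
      exact (hno' 1 (β₁ / β₂) one_ne_zero (by field_simp) (by simp [k₁, k₂])).elim
  · have hβ₂ := left_ne_zero_of_mul hq₂
    have hq₁ : β₁ * γ₁ ≠ 0 := by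
      rw [hq]
      exact mul_ne_zero (pow_ne_zero 2 ht) hq₂
    have hβ₁ := left_ne_zero_of_mul hq₁
    refine (hno' (t * β₂ / β₁) t (div_ne_zero (mul_ne_zero ht hβ₂) hβ₁) (by field_simp) ?_).elim
    field_simp
    linear_combination hq

lemma exists_tri_of_not_scalar (hp : Odd p) (h2 : (2 : ZMod p) ≠ 0)
    (hd₁ : ∀ h ∈ H₁, (phi p h).val.IsDiag) (hd₂ : ∀ h ∈ H₂, (phi p h).val.IsDiag)
    (hs₁ : ∃ h ∈ H₁, (phi p h).val 0 0 ≠ (phi p h).val 1 1)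
    (hs₂ : ∃ h ∈ H₂, (phi p h).val 0 0 ≠ (phi p h).val 1 1)
    (h : IsNontriviallyLocallyConjugate H₁ H₂) :
    ∃ E, IsConjugateSubgroup H₁ (triSubgroup E) ∧
      IsConjugateSubgroup H₂ (triSubgroup (swapSubgroup E)) := by
  obtain ⟨K₁, c₁, d₁, x₁⟩ := exists_conj_diagHom_mem hd₁ hs₁
  obtain ⟨K₂, c₂, d₂, x₂⟩ := exists_conj_diagHom_mem hd₂ hs₂
  have s₁ := isSplit_of_diagHom_mem d₁ x₁
  have s₂ := isSplit_of_diagHom_mem d₂ x₂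
  have h' := (isNontriviallyLocallyConjugate_congr c₁ c₂).1 h
  suffices hK : ∃ E, IsConjugateSubgroup K₁ (triSubgroup E) ∧
      IsConjugateSubgroup K₂ (triSubgroup (swapSubgroup E)) by
    obtain ⟨E, e₁, e₂⟩ := hK
    exact ⟨E, c₁.trans e₁, c₂.trans e₂⟩
  rcases s₁.comap_eq_or_eq hp s₂ h'.1 with hE | hE
  · exact s₁.exists_tri_of_comap_eq h2 s₂ hE h'
  · rw [← comap_map_conj_swapGL] at hE
    have c := isConjugateSubgroup_map (swapGL p) K₂
    have cr : IsConjugateSubgroup K₁ K₁ := ⟨1, by ext; simp⟩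
    obtain ⟨E, e₁, e₂⟩ := s₁.exists_tri_of_comap_eq h2 s₂.map_conj_swapGL hE
      ((isNontriviallyLocallyConjugate_congr cr c).1 h')
    exact ⟨E, e₁, c.trans e₂⟩

lemma phi_scalar_of_isConj {g h : GL2 (p ^ 2)} (hg : (phi p g).val.IsDiag)
    (hs : (phi p g).val 0 0 = (phi p g).val 1 1) (hc : IsConj g h) :
    (phi p h).val 0 0 = (phi p h).val 1 1 := by
  obtain ⟨k, rfl⟩ := isConj_iff.1 hc
  obtain ⟨s, A, -, -, rfl⟩ := exists_scalar_mul_kap (Subgroup.mem_top g) hg hs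
  rw [conj_scalar_mul_kap, map_mul, phi_kap, mul_one, phi_diagHom_val]
  rfl

lemma exists_tri (hp : Odd p) (hd₁ : ∀ h ∈ H₁, (phi p h).val.IsDiag)
    (hd₂ : ∀ h ∈ H₂, (phi p h).val.IsDiag) (h : IsNontriviallyLocallyConjugate H₁ H₂) :
    ∃ E, IsConjugateSubgroup H₁ (triSubgroup E) ∧
      IsConjugateSubgroup H₂ (triSubgroup (swapSubgroup E)) := by
  have h2 : (2 : ZMod p) ≠ 0 := by
    intro h2
    have h3 : ((2 : ℕ) : ZMod p) = 0 := by exact_mod_cast h2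
    rw [ZMod.natCast_eq_zero_iff, Nat.prime_dvd_prime_iff_eq Fact.out Nat.prime_two] at h3
    subst h3
    exact absurd hp (by decide)
  have key : ∀ {H K : Subgroup (GL2 (p ^ 2))}, IsLocallyConjugate H K →
      (∀ h ∈ H, (phi p h).val.IsDiag) → (∀ h ∈ H, (phi p h).val 0 0 = (phi p h).val 1 1) →
      ∀ h ∈ K, (phi p h).val 0 0 = (phi p h).val 1 1 := by
    rintro H K ⟨f, hf⟩ hd hs k hk
    have h1 := hf (f.symm ⟨k, hk⟩)
    rw [Equiv.apply_symm_apply] at h1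
    exact phi_scalar_of_isConj (hd _ (f.symm _).2) (hs _ (f.symm _).2) h1
  by_cases hs : ∀ h ∈ H₁, (phi p h).val 0 0 = (phi p h).val 1 1
  · exact exists_tri_of_scalar h2 hd₁ hd₂ hs (key h.1 hd₁ hs) h
  · have hs' : ¬ ∀ h ∈ H₂, (phi p h).val 0 0 = (phi p h).val 1 1 :=
      fun hs' => hs (key h.1.symm hd₂ hs')
    push Not at hs hs'
    exact exists_tri_of_not_scalar hp h2 hd₁ hd₂ hs hs' h

end

lemma isDiag_of_mem_map_diagHom {p : ℕ} [Fact p.Prime]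
    {E : Subgroup ((ZMod (p ^ 2))ˣ × (ZMod (p ^ 2))ˣ)} :
    ∀ g ∈ E.map (diagHom p), (↑g : Matrix (Fin 2) (Fin 2) (ZMod (p ^ 2))).IsDiag := by
  rintro _ ⟨x, -, rfl⟩
  exact isDiag_diagHom x

/-- (The split Cartan case.) Suppose every element of `φ(Hᵢ)` is
diagonal. Then `H₁` and `H₂` are nontrivially locally conjugate in `GL₂(ℤ/p²ℤ)` iff
there are diagonal subgroups `D ≠ D'` of `GL₂(ℤ/p²ℤ)` with `D' = σ D σ⁻¹`
(`σ = !![0,1;1,0]`) such that `H₁` and `H₂` are, in some order, conjugate to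
`⟨D, 1 + p•!![0,1;0,0]⟩` and `⟨D', 1 + p•!![0,1;0,0]⟩`. -/
theorem split_cartan_case {p : ℕ} [Fact p.Prime] (hp : Odd p)
    (H₁ H₂ : Subgroup (GL2 (p^2)))
    (h₁ : ∀ g ∈ H₁, (↑(phi p g) : Matrix (Fin 2) (Fin 2) (ZMod p)).IsDiag)
    (h₂ : ∀ g ∈ H₂, (↑(phi p g) : Matrix (Fin 2) (Fin 2) (ZMod p)).IsDiag) :
    IsNontriviallyLocallyConjugate H₁ H₂ ↔
      ∃ D D' : Subgroup (GL2 (p^2)),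
        (∀ g ∈ D, (↑g : Matrix (Fin 2) (Fin 2) (ZMod (p^2))).IsDiag) ∧
        (∀ g ∈ D', (↑g : Matrix (Fin 2) (Fin 2) (ZMod (p^2))).IsDiag) ∧
        D' = Subgroup.map (MulAut.conj (swapGL p)).toMonoidHom D ∧
        D ≠ D' ∧
        ((IsConjugateSubgroup H₁
            (Subgroup.closure ((D : Set (GL2 (p^2))) ∪ {kerUnit !![0, 1; 0, 0]})) ∧
          IsConjugateSubgroup H₂
            (Subgroup.closure ((D' : Set (GL2 (p^2))) ∪ {kerUnit !![0, 1; 0, 0]}))) ∨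
         (IsConjugateSubgroup H₁
            (Subgroup.closure ((D' : Set (GL2 (p^2))) ∪ {kerUnit !![0, 1; 0, 0]})) ∧
          IsConjugateSubgroup H₂
            (Subgroup.closure ((D : Set (GL2 (p^2))) ∪ {kerUnit !![0, 1; 0, 0]})))) := by
  constructor
  · intro h
    obtain ⟨E, e₁, e₂⟩ := exists_tri hp h₁ h₂ h
    refine ⟨E.map (diagHom p), (swapSubgroup E).map (diagHom p), isDiag_of_mem_map_diagHom,
      isDiag_of_mem_map_diagHom, (map_swapSubgroup E).symm, fun he => ?_, Or.inl ⟨?_, ?_⟩⟩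
    · have hE : E = swapSubgroup E := Subgroup.map_injective diagHom_injective he
      rw [← hE] at e₂
      exact h.2 (e₁.trans e₂.symm)
    · rwa [closure_eq_triSubgroup]
    · rwa [closure_eq_triSubgroup]
  · rintro ⟨D, _, hD, -, rfl, hne, h⟩
    obtain ⟨E, rfl⟩ : ∃ E : Subgroup ((ZMod (p ^ 2))ˣ × (ZMod (p ^ 2))ˣ), D = E.map (diagHom p) := by
      refine ⟨D.comap (diagHom p), (Subgroup.map_comap_eq_self fun g hg => ?_).symm⟩
      obtain ⟨x, rfl⟩ := exists_diagHom (hD g hg)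
      exact ⟨x, rfl⟩
    rw [map_swapSubgroup] at hne h
    have hE : E ≠ swapSubgroup E := fun he => hne (congrArg _ he)
    simp only [closure_eq_triSubgroup] at h
    rcases h with ⟨e₁, e₂⟩ | ⟨e₁, e₂⟩
    · exact (isNontriviallyLocallyConjugate_congr e₁ e₂).2
        (isNontriviallyLocallyConjugate_triSubgroup hE)
    · have h := isNontriviallyLocallyConjugate_triSubgroup (E := swapSubgroup E)
        (by rw [swapSubgroup_swapSubgroup]; exact hE.symm)
      rw [swapSubgroup_swapSubgroup] at h
      exact (isNontriviallyLocallyConjugate_congr e₁ e₂).2 h
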